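/- Let Λ₁ and Λ₂ be finite dimensional basic algebras over an algebraically closed field K and assume that Λ₂ is a factor algebra of Λ₁. If Λ₂ is τ-tilting infinite, then Λ₁ is τ-tilting infinite. -/

import Mathlib

/-!
Core definitions for τ-tilting theory of finite dimensional algebras.

Throughout, for an algebra `Λ`, *right* `Λ`-modules are formalized as left modules
over the opposite ring `Λᵐᵒᵖ` (the category `RMod Λ := ModuleCat Λᵐᵒᵖ`).

τ-rigidity is formalized via the standard projective-presentation criterion of
Auslander–Smalø/Adachi–Iyama–Reiten: a finitely generated module `M` is τ-rigid iff it admits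
a (finite) projective presentation `P₁ → P₀ → M → 0` such that
`Hom(P₀, M) → Hom(P₁, M)` is surjective.
-/

noncomputable section

namespace TwoPoint

/-- A module is indecomposable if it is nonzero and admits no nontrivial direct sum
decomposition. -/
def IsIndecModule (R : Type) [Ring R] (M : Type) [AddCommGroup M] [Module R M] : Prop :=
  Nontrivial M ∧ ∀ N₁ N₂ : Submodule R M, IsCompl N₁ N₂ → N₁ = ⊥ ∨ N₂ = ⊥

/-- `M` decomposes as a finite direct sum of indecomposable submodules having exactly `n`
isomorphism classes. -/
def HasIndecClassCount (R : Type) [Ring R] (M : ModuleCat.{0} R) (n : ℕ) : Prop :=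
  ∃ (k : ℕ) (N : Fin k → Submodule R M),
    DirectSum.IsInternal N ∧ (∀ i, IsIndecModule R (N i)) ∧
    ∃ c : Fin k → Fin n, Function.Surjective c ∧
      ∀ i j, (c i = c j ↔ Nonempty ((N i) ≃ₗ[R] (N j)))

/-- `M` is basic: it decomposes as a finite direct sum of pairwise nonisomorphic
indecomposable submodules. -/
def IsBasicModuleCat (R : Type) [Ring R] (M : ModuleCat.{0} R) : Prop :=
  ∃ (k : ℕ) (N : Fin k → Submodule R M),
    DirectSum.IsInternal N ∧ (∀ i, IsIndecModule R (N i)) ∧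
    ∀ i j, i ≠ j → IsEmpty ((N i) ≃ₗ[R] (N j))

/-- τ-rigidity, via the projective presentation criterion: there is a finite projective
presentation `P₁ —f→ P₀ —g→ M → 0` such that `Hom(—, M)` applied to `f` is surjective,
i.e. `Hom_Λ(M, τM) = 0`. -/
def IsTauRigidCat (R : Type) [Ring R] (M : ModuleCat.{0} R) : Prop :=
  Module.Finite R M ∧
  ∃ (P₁ P₀ : ModuleCat.{0} R) (f : P₁ →ₗ[R] P₀) (g : P₀ →ₗ[R] M),
    Module.Finite R P₁ ∧ Module.Projective R P₁ ∧
    Module.Finite R P₀ ∧ Module.Projective R P₀ ∧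
    Function.Surjective g ∧ LinearMap.range f = LinearMap.ker g ∧
    ∀ h : P₁ →ₗ[R] M, ∃ h' : P₀ →ₗ[R] M, h = h'.comp f

/-- Support τ-tilting module, via support τ-tilting pairs `(M, P)` (Adachi–Iyama–Reiten):
`M` is τ-rigid, `P` is finitely generated projective with `Hom(P, M) = 0`, and
`|M| + |P| = |R|` where `|X|` is the number of isomorphism classes of indecomposable
direct summands. -/
def IsSupportTauTiltingCat (R : Type) [Ring R] (M : ModuleCat.{0} R) : Prop :=
  IsTauRigidCat R M ∧
  ∃ (P : ModuleCat.{0} R) (p q r : ℕ),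
    Module.Finite R P ∧ Module.Projective R P ∧
    (∀ f : P →ₗ[R] M, f = 0) ∧
    HasIndecClassCount R M p ∧ HasIndecClassCount R P q ∧
    HasIndecClassCount R (ModuleCat.of R R) r ∧ p + q = r

/-- The category of (finitely generated) right `Λ`-modules, as left `Λᵐᵒᵖ`-modules. -/
abbrev RMod (Λ : Type) [Ring Λ] := ModuleCat.{0} Λᵐᵒᵖ

/-- Basic support τ-tilting right `Λ`-module. -/
def IsBasicSupportTauTilting (Λ : Type) [Ring Λ] (M : RMod Λ) : Prop :=
  IsSupportTauTiltingCat Λᵐᵒᵖ M ∧ IsBasicModuleCat Λᵐᵒᵖ M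

/-- `Λ` is τ-tilting finite: there are only finitely many isomorphism classes of basic
support τ-tilting right `Λ`-modules. -/
def IsTauTiltingFinite (Λ : Type) [Ring Λ] : Prop :=
  ∃ (n : ℕ) (L : Fin n → RMod Λ),
    ∀ M : RMod Λ, IsBasicSupportTauTilting Λ M → ∃ i, Nonempty (M ≃ₗ[Λᵐᵒᵖ] L i)

/-- `Λ` has exactly `n` isomorphism classes of basic support τ-tilting modules. -/
def SupportTauTiltingCount (Λ : Type) [Ring Λ] (n : ℕ) : Prop :=
  ∃ L : Fin n → RMod Λ,
    (∀ i, IsBasicSupportTauTilting Λ (L i)) ∧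
    (∀ i j, Nonempty ((L i) ≃ₗ[Λᵐᵒᵖ] (L j)) → i = j) ∧
    ∀ M : RMod Λ, IsBasicSupportTauTilting Λ M → ∃ i, Nonempty (M ≃ₗ[Λᵐᵒᵖ] L i)

/-- `Fac M ⊆ Fac N`: every factor module of a finite direct sum of copies of `M` is also a
factor module of a finite direct sum of copies of `N`.  This is the partial order on
support τ-tilting modules. -/
def FacLE (Λ : Type) [Ring Λ] (M N : RMod Λ) : Prop :=
  ∀ X : RMod Λ,
    (∃ (k : ℕ) (f : (Fin k → M) →ₗ[Λᵐᵒᵖ] X), Function.Surjective f) →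
    (∃ (k : ℕ) (f : (Fin k → N) →ₗ[Λᵐᵒᵖ] X), Function.Surjective f)

/-- The Hasse quiver of the poset `sτ-tilt Λ` is of type `H_{m,n}`: the poset of
isomorphism classes of basic support τ-tilting modules is isomorphic to the poset
consisting of a greatest element, a least element, and two incomparable chains with `m`
resp. `n` elements in between (hence two directed paths from `Λ` to `0` with `m` resp. `n`
intermediate vertices). -/
def HasseType (Λ : Type) [Ring Λ] (m n : ℕ) : Prop :=
  ∃ T : WithTop (WithBot (Fin m ⊕ Fin n)) → RMod Λ,
    (∀ x, IsBasicSupportTauTilting Λ (T x)) ∧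
    (∀ x y, Nonempty ((T x) ≃ₗ[Λᵐᵒᵖ] (T y)) → x = y) ∧
    (∀ M : RMod Λ, IsBasicSupportTauTilting Λ M → ∃ x, Nonempty (M ≃ₗ[Λᵐᵒᵖ] T x)) ∧
    ∀ x y, x ≤ y ↔ FacLE Λ (T x) (T y)

/-- `Λ` is τ-tilting finite with exactly `N` basic support τ-tilting modules and Hasse
quiver of type `H_{m,n}`. -/
def TauTiltingData (Λ : Type) [Ring Λ] (N m n : ℕ) : Prop :=
  IsTauTiltingFinite Λ ∧ SupportTauTiltingCount Λ N ∧ HasseType Λ m n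

/-- `B` is a factor algebra of `Λ`: there is a surjective `K`-algebra homomorphism
`Λ → B`. -/
def IsFactorAlgebra (K : Type) [CommRing K] (B Λ : Type) [Ring B] [Ring Λ]
    [Algebra K B] [Algebra K Λ] : Prop :=
  ∃ φ : Λ →ₐ[K] B, Function.Surjective φ

/-- `Λ` is a basic algebra: the regular right module decomposes into pairwise
nonisomorphic indecomposables. -/
def IsBasicAlgebra (Λ : Type) [Ring Λ] : Prop :=
  IsBasicModuleCat Λᵐᵒᵖ (ModuleCat.of Λᵐᵒᵖ Λᵐᵒᵖ)

/-- `Λ` is representation-finite: finitely many isomorphism classes of indecomposable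
finitely generated right modules. -/
def IsRepFinite (Λ : Type) [Ring Λ] : Prop :=
  ∃ (n : ℕ) (L : Fin n → RMod Λ), ∀ M : RMod Λ,
    Module.Finite Λᵐᵒᵖ M → IsIndecModule Λᵐᵒᵖ M → ∃ i, Nonempty (M ≃ₗ[Λᵐᵒᵖ] L i)

end TwoPoint

namespace TwoPoint

open Function

/-- A property of modules over `R`. -/
abbrev ModPred (R : Type) [Ring R] := ∀ (M : Type) [AddCommGroup M] [Module R M], Prop

/-- A class of finitely generated modules closed under quotients and extensions. -/
structure IsTorsionClass {R : Type} [Ring R] (T : ModPred R) : Prop where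
  finite : ∀ (M : Type) [AddCommGroup M] [Module R M], T M → Module.Finite R M
  of_subsingleton : ∀ (M : Type) [AddCommGroup M] [Module R M], Subsingleton M → T M
  of_surjective : ∀ {M N : Type} [AddCommGroup M] [Module R M] [AddCommGroup N] [Module R N]
    (f : M →ₗ[R] N), Surjective f → T M → T N
  of_extension : ∀ {E N : Type} [AddCommGroup E] [Module R E] [AddCommGroup N] [Module R N]
    (f : E →ₗ[R] N), Surjective f → T (LinearMap.ker f) → T N → T E

/-- The factor modules of finite direct sums of copies of `M`. -/
def Fac {R : Type} [Ring R] (M : Type) [AddCommGroup M] [Module R M] : ModPred R :=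
  fun N _ _ => ∃ (k : ℕ) (f : (Fin k → M) →ₗ[R] N), Surjective f

/-- Maps out of `X` lift along surjections with kernel in `T`, that is, `Ext¹(X, T) = 0`. -/
def LiftsAlong {R : Type} [Ring R] (T : ModPred R) (X : Type) [AddCommGroup X] [Module R X] :
    Prop :=
  ∀ {E Y : Type} [AddCommGroup E] [Module R E] [AddCommGroup Y] [Module R Y]
    (q : E →ₗ[R] Y), Surjective q → T (LinearMap.ker q) → ∀ f : X →ₗ[R] Y,
      ∃ l : X →ₗ[R] E, q ∘ₗ l = f

/-- `ι : Q → A` is a left `T`-approximation of `Q`. -/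
def IsLeftApprox {R : Type} [Ring R] (T : ModPred R) {Q A : Type} [AddCommGroup Q] [Module R Q]
    [AddCommGroup A] [Module R A] (ι : Q →ₗ[R] A) : Prop :=
  T A ∧ ∀ {N : Type} [AddCommGroup N] [Module R N], T N → ∀ h : Q →ₗ[R] N,
    ∃ ψ : A →ₗ[R] N, ψ ∘ₗ ι = h

/-- Kernels of those maps between modules in `T` along which maps out of `U` lift are in `T`. -/
def HasApproxKernels {R : Type} [Ring R] (T : ModPred R) (U : Type) [AddCommGroup U]
    [Module R U] : Prop :=
  ∀ {N N' : Type} [AddCommGroup N] [Module R N] [AddCommGroup N'] [Module R N']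
    (φ : N →ₗ[R] N'), T N → (∀ g : U →ₗ[R] N', ∃ l : U →ₗ[R] N, φ ∘ₗ l = g) →
      T (LinearMap.ker φ)

section

variable {R : Type} [Ring R] {T : ModPred R}
variable {M N : Type} [AddCommGroup M] [Module R M] [AddCommGroup N] [Module R N]

theorem exists_comp_eq_of_ker_le {P : Type} [AddCommGroup P] [Module R P] {f : M →ₗ[R] N}
    (hf : Surjective f) {g : M →ₗ[R] P} (h : LinearMap.ker f ≤ LinearMap.ker g) :
    ∃ g' : N →ₗ[R] P, g' ∘ₗ f = g := by
  refine ⟨(LinearMap.ker f).liftQ g h ∘ₗ (f.quotKerEquivOfSurjective hf).symm.toLinearMap, ?_⟩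
  ext x
  have : (f.quotKerEquivOfSurjective hf).symm (f x) = Submodule.Quotient.mk x := by
    rw [LinearEquiv.symm_apply_eq]; rfl
  simp [this]

namespace IsTorsionClass

theorem of_equiv (hT : IsTorsionClass T) (e : M ≃ₗ[R] N) (h : T M) : T N :=
  hT.of_surjective e.toLinearMap e.surjective h

theorem range (hT : IsTorsionClass T) (f : M →ₗ[R] N) (h : T M) : T (LinearMap.range f) :=
  hT.of_surjective f.rangeRestrict f.surjective_rangeRestrict h

theorem prod (hT : IsTorsionClass T) (hM : T M) (hN : T N) : T (M × N) := by
  refine hT.of_extension (LinearMap.fst R M N) LinearMap.fst_surjective ?_ hM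
  rw [LinearMap.ker_fst]
  exact hT.range _ hN

theorem sup (hT : IsTorsionClass T) {L₁ L₂ : Submodule R M} (h₁ : T L₁) (h₂ : T L₂) :
    T ↥(L₁ ⊔ L₂) := by
  have : L₁ ⊔ L₂ = LinearMap.range (L₁.subtype.coprod L₂.subtype) := by
    rw [LinearMap.range_coprod]; simp
  rw [this]
  exact hT.range _ (hT.prod h₁ h₂)

theorem of_iSup {ι : Type*} [Finite ι] (hT : IsTorsionClass T) {X : ι → Type}
    [∀ i, AddCommGroup (X i)] [∀ i, Module R (X i)] (hX : ∀ i, T (X i))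
    (g : ∀ i, X i →ₗ[R] N) (hg : ⨆ i, LinearMap.range (g i) = ⊤) : T N := by
  classical
  have := Fintype.ofFinite ι
  have key : ∀ s : Finset ι, T ↥(s.sup fun i => LinearMap.range (g i)) := by
    intro s
    induction s using Finset.induction_on with
    | empty => exact hT.of_subsingleton _ (by rw [Finset.sup_empty]; infer_instance)
    | insert a s _ ih =>
      rw [Finset.sup_insert]
      exact hT.sup (hT.range _ (hX a)) ih
  have h := key Finset.univ
  rw [Finset.sup_univ_eq_iSup, hg] at h
  exact hT.of_equiv Submodule.topEquiv h

theorem pi {ι : Type} [Finite ι] (hT : IsTorsionClass T) {X : ι → Type}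
    [∀ i, AddCommGroup (X i)] [∀ i, Module R (X i)] (hX : ∀ i, T (X i)) : T (∀ i, X i) := by
  classical
  exact hT.of_iSup hX (LinearMap.single R X) (LinearMap.iSup_range_single R X)

theorem of_fac (hT : IsTorsionClass T) (hM : T M) (h : Fac (R := R) M N) : T N := by
  obtain ⟨k, f, hf⟩ := h
  exact hT.of_surjective f hf (hT.pi fun _ => hM)

/-- The intersection of a torsion class with the left orthogonal of a module. -/
theorem inf_orthogonal (hT : IsTorsionClass T) (B : Type) [AddCommGroup B] [Module R B] :
    IsTorsionClass (R := R) fun N _ _ => T N ∧ ∀ f : N →ₗ[R] B, f = 0 where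
  finite N _ _ h := hT.finite N h.1
  of_subsingleton N _ _ h := ⟨hT.of_subsingleton N h, fun f => Subsingleton.elim _ _⟩
  of_surjective f hf h := ⟨hT.of_surjective f hf h.1, fun g => by
    have := h.2 (g ∘ₗ f)
    ext y
    obtain ⟨x, rfl⟩ := hf y
    exact LinearMap.congr_fun this x⟩
  of_extension f hf h₁ h₂ := ⟨hT.of_extension f hf h₁.1 h₂.1, fun g => by
    have h := h₁.2 (g ∘ₗ (LinearMap.ker f).subtype)
    have hker : LinearMap.ker f ≤ LinearMap.ker g := fun x hx =>
      LinearMap.congr_fun h ⟨x, hx⟩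
    obtain ⟨g', rfl⟩ := exists_comp_eq_of_ker_le hf hker
    rw [h₂.2 g', LinearMap.zero_comp]⟩

/-- Every module has a largest submodule in `T` below a given one. -/
theorem exists_maximal_sub [IsNoetherian R N] (hT : IsTorsionClass T) (L : Submodule R N) :
    ∃ t : Submodule R N, t ≤ L ∧ T t ∧ ∀ t' : Submodule R N, t' ≤ L → T t' → t' ≤ t := by
  obtain ⟨t, ⟨htL, ht⟩, hmax⟩ := wellFounded_gt.has_min
    {t : Submodule R N | t ≤ L ∧ T t}
    ⟨⊥, bot_le, hT.of_subsingleton _ inferInstance⟩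
  refine ⟨t, htL, ht, fun t' h' hT' => ?_⟩
  have := hmax (t ⊔ t') ⟨sup_le htL h', hT.sup ht hT'⟩
  by_contra hc
  exact this (lt_of_le_of_ne le_sup_left fun h => hc (by rw [h]; exact le_sup_right))

/-- Maps from `T` to the quotient by the largest submodule in `T` below `L` vanish as soon as their
image is contained in the image of `L`. -/
theorem eq_zero_of_maximal_sub (hT : IsTorsionClass T) {L t : Submodule R N}
    (htL : t ≤ L) (ht : T t) (hmax : ∀ t' : Submodule R N, t' ≤ L → T t' → t' ≤ t)
    {W : Type} [AddCommGroup W] [Module R W] (hW : T W) (f : W →ₗ[R] N ⧸ t)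
    (hf : LinearMap.range f ≤ L.map t.mkQ) : f = 0 := by
  set P := (LinearMap.range f).comap t.mkQ with hP
  have hPL : P ≤ L := by
    intro x hx
    obtain ⟨y, hy, hxy⟩ := hf hx
    have : x - y ∈ t := by
      rw [← Submodule.ker_mkQ t, LinearMap.mem_ker, map_sub, hxy, sub_self]
    have := L.add_mem (htL this) hy
    simpa using this
  have htP : t ≤ P := by
    intro x hx
    have : t.mkQ x = 0 := by simpa using hx
    rw [hP, Submodule.mem_comap, this]
    exact zero_mem _
  let q : P →ₗ[R] LinearMap.range f := t.mkQ.restrict (p := P) fun x hx => hx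
  have hq : Surjective q := by
    rintro ⟨y, hy⟩
    obtain ⟨x, rfl⟩ := t.mkQ_surjective y
    exact ⟨⟨x, hy⟩, rfl⟩
  have hTP : T P := by
    refine hT.of_extension q hq ?_ (hT.range f hW)
    refine hT.of_surjective
      ((Submodule.inclusion htP).codRestrict (LinearMap.ker q) fun x => ?_) ?_ ht
    · apply Subtype.ext
      change t.mkQ x.1 = 0
      simp
    · rintro ⟨⟨x, hx⟩, hx'⟩
      have : t.mkQ x = 0 := congrArg Subtype.val hx'
      exact ⟨⟨x, by simpa using this⟩, rfl⟩
  have := hmax P hPL hTP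
  ext w
  obtain ⟨x, hx⟩ := t.mkQ_surjective (f w)
  have hxP : x ∈ P := ⟨w, hx.symm⟩
  rw [← hx]
  simpa using this hxP

end IsTorsionClass

namespace LiftsAlong

variable {X X' : Type} [AddCommGroup X] [Module R X] [AddCommGroup X'] [Module R X']

theorem of_retract (h : LiftsAlong T X) (i : X' →ₗ[R] X) (r : X →ₗ[R] X')
    (hri : r ∘ₗ i = LinearMap.id) : LiftsAlong T X' := by
  intro E Y _ _ _ _ q hq hk f
  obtain ⟨l, hl⟩ := h q hq hk (f ∘ₗ r)
  exact ⟨l ∘ₗ i, by rw [← LinearMap.comp_assoc, hl, LinearMap.comp_assoc, hri,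
    LinearMap.comp_id]⟩

theorem pi {ι : Type} [Finite ι] {X : ι → Type} [∀ i, AddCommGroup (X i)]
    [∀ i, Module R (X i)] (h : ∀ i, LiftsAlong T (X i)) : LiftsAlong T (∀ i, X i) := by
  classical
  have := Fintype.ofFinite ι
  intro E Y _ _ _ _ q hq hk f
  choose l hl using fun i => h i q hq hk (f ∘ₗ LinearMap.single R X i)
  refine ⟨LinearMap.lsum R X ℕ l, LinearMap.pi_ext' fun i => ?_⟩
  rw [← hl i]
  ext x
  have : (LinearMap.lsum R X ℕ l) (Pi.single i x) = l i x :=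
    LinearMap.lsum_piSingle _ _ _ _ i x
  exact congrArg q this

theorem prod (h : LiftsAlong T X) (h' : LiftsAlong T X') : LiftsAlong T (X × X') := by
  intro E Y _ _ _ _ q hq hk f
  obtain ⟨l, hl⟩ := h q hq hk (f ∘ₗ LinearMap.inl R X X')
  obtain ⟨l', hl'⟩ := h' q hq hk (f ∘ₗ LinearMap.inr R X X')
  refine ⟨l.coprod l', ?_⟩
  rw [LinearMap.comp_coprod, hl, hl', ← LinearMap.comp_coprod, LinearMap.coprod_inl_inr,
    LinearMap.comp_id]

theorem of_section (hT : IsTorsionClass T)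
    (h : ∀ {E : Type} [AddCommGroup E] [Module R E] (p : E →ₗ[R] X), Surjective p →
      T (LinearMap.ker p) → ∃ s : X →ₗ[R] E, p ∘ₗ s = LinearMap.id) : LiftsAlong T X := by
  intro E Y _ _ _ _ q hq hk f
  let d : E × X →ₗ[R] Y := q ∘ₗ LinearMap.fst R E X - f ∘ₗ LinearMap.snd R E X
  have hd : ∀ z : LinearMap.ker d, q z.1.1 = f z.1.2 := fun z => by
    have := z.2
    rw [LinearMap.mem_ker] at this
    exact sub_eq_zero.mp this
  let p : LinearMap.ker d →ₗ[R] X := LinearMap.snd R E X ∘ₗ (LinearMap.ker d).subtype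
  have hp : Surjective p := by
    intro x
    obtain ⟨e, he⟩ := hq (f x)
    exact ⟨⟨(e, x), by simp [d, he]⟩, rfl⟩
  have hkp : T (LinearMap.ker p) := by
    let j : LinearMap.ker q →ₗ[R] LinearMap.ker d :=
      (LinearMap.inl R E X ∘ₗ (LinearMap.ker q).subtype).codRestrict _ fun x => by simp [d]
    refine hT.of_surjective (j.codRestrict (LinearMap.ker p) fun x => ?_) ?_ hk
    · rfl
    · rintro ⟨⟨⟨e, x⟩, hz⟩, hx⟩
      have hx0 : x = 0 := hx
      subst hx0
      refine ⟨⟨e, ?_⟩, rfl⟩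
      have := hd ⟨(e, 0), hz⟩
      simpa using this
  obtain ⟨s, hs⟩ := h p hp hkp
  refine ⟨LinearMap.fst R E X ∘ₗ (LinearMap.ker d).subtype ∘ₗ s, ?_⟩
  ext x
  have h1 := hd (s x)
  have h2 : (s x).1.2 = x := LinearMap.congr_fun hs x
  rw [h2] at h1
  exact h1

end LiftsAlong

/-- A left approximation can be shrunk to one whose compatible endomorphisms are bijective. -/
theorem IsLeftApprox.exists_minimal [IsArtinianRing R] (hT : IsTorsionClass T)
    {Q A : Type} [AddCommGroup Q] [Module R Q] [AddCommGroup A] [Module R A] {ι : Q →ₗ[R] A}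
    (h : IsLeftApprox T ι) :
    ∃ (L : Submodule R A) (j : Q →ₗ[R] L), IsLeftApprox T j ∧
      ∀ e : L →ₗ[R] L, e ∘ₗ j = j → Bijective e := by
  have := hT.finite A h.1
  obtain ⟨L, ⟨r, hrL, hr⟩, hmin⟩ := wellFounded_lt.has_min
    {L : Submodule R A | ∃ r : A →ₗ[R] A, (∀ x, r x ∈ L) ∧ r ∘ₗ ι = ι}
    ⟨⊤, LinearMap.id, fun _ => trivial, rfl⟩
  have hmin' : ∀ L' ≤ L, (∃ r : A →ₗ[R] A, (∀ x, r x ∈ L') ∧ r ∘ₗ ι = ι) → L' = L :=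
    fun L' hL' h' => by_contra fun hne => hmin L' h' (lt_of_le_of_ne hL' hne)
  have hι : ∀ x, ι x ∈ L := fun x => by
    rw [← hr]; exact hrL _
  let r' : A →ₗ[R] L := r.codRestrict L hrL
  refine ⟨L, ι.codRestrict L hι, ⟨?_, fun hN g => ?_⟩, fun e he => ?_⟩
  · have : LinearMap.range r = L := hmin' _ (by rintro _ ⟨x, rfl⟩; exact hrL x)
      ⟨r, fun x => ⟨x, rfl⟩, hr⟩
    rw [← this]
    exact hT.range r h.1
  · obtain ⟨ψ, hψ⟩ := h.2 hN g
    exact ⟨ψ ∘ₗ L.subtype, hψ⟩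
  · have hsurj : Surjective e := by
      have hle : (LinearMap.range e).map L.subtype ≤ L := Submodule.map_subtype_le _ _
      have := hmin' _ hle ⟨L.subtype ∘ₗ e ∘ₗ r', fun x => ⟨e (r' x), ⟨_, rfl⟩, rfl⟩, ?_⟩
      · intro y
        have hy : y.1 ∈ (LinearMap.range e).map L.subtype := by rw [this]; exact y.2
        obtain ⟨_, ⟨z, rfl⟩, hz⟩ := hy
        exact ⟨z, Subtype.ext hz⟩
      · ext x
        have h1 : r' (ι x) = ι.codRestrict L hι x :=
          Subtype.ext (LinearMap.congr_fun hr x)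
        have h2 := LinearMap.congr_fun he x
        simp only [LinearMap.comp_apply] at h2 ⊢
        rw [h1, h2]
        rfl
    exact ⟨(IsNoetherian.injective_of_surjective_endomorphism e hsurj), hsurj⟩

variable {Q A : Type} [AddCommGroup Q] [Module R Q] [AddCommGroup A] [Module R A] {j : Q →ₗ[R] A}

theorem IsLeftApprox.liftsAlong [Module.Projective R Q] (hT : IsTorsionClass T)
    (hj : IsLeftApprox T j) (hmin : ∀ e : A →ₗ[R] A, e ∘ₗ j = j → Bijective e) :
    LiftsAlong T A := by
  refine LiftsAlong.of_section hT fun {E} _ _ p hp hk => ?_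
  have hE : T E := hT.of_extension p hp hk hj.1
  obtain ⟨l, hl⟩ := Module.projective_lifting_property p j hp
  obtain ⟨ψ, hψ⟩ := hj.2 hE l
  have hb := hmin (p ∘ₗ ψ) (by rw [LinearMap.comp_assoc, hψ, hl])
  let e := LinearEquiv.ofBijective (p ∘ₗ ψ) hb
  refine ⟨ψ ∘ₗ e.symm.toLinearMap, ?_⟩
  ext x
  exact e.apply_symm_apply x

theorem IsLeftApprox.liftsAlong_coker (hj : IsLeftApprox T j) (hA : LiftsAlong T A) :
    LiftsAlong T (A ⧸ LinearMap.range j) := by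
  intro E Y _ _ _ _ q hq hk f
  obtain ⟨l, hl⟩ := hA q hq hk (f ∘ₗ (LinearMap.range j).mkQ)
  have hl' : ∀ x, q (l x) = f ((LinearMap.range j).mkQ x) := LinearMap.congr_fun hl
  obtain ⟨ψ, hψ⟩ := hj.2 hk ((l ∘ₗ j).codRestrict (LinearMap.ker q) fun x => by
    have : (LinearMap.range j).mkQ (j x) = 0 := by simp
    rw [LinearMap.comp_apply, LinearMap.mem_ker, hl', this, map_zero])
  have hψ' : ∀ x, (ψ (j x)).1 = l (j x) := fun x =>
    congrArg Subtype.val (LinearMap.congr_fun hψ x)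
  refine ⟨(LinearMap.range j).liftQ (l - (LinearMap.ker q).subtype ∘ₗ ψ) ?_, ?_⟩
  · rintro _ ⟨x, rfl⟩
    simp [hψ']
  · refine Submodule.linearMap_qext _ ?_
    ext x
    have := (ψ x).2
    rw [LinearMap.mem_ker] at this
    simp only [LinearMap.comp_apply, Submodule.mkQ_apply, Submodule.liftQ_apply,
      LinearMap.sub_apply, map_sub, Submodule.subtype_apply, this, sub_zero]
    exact hl' x

/-- Modules all of whose elements are hit by maps from an object of `T` are in `T`. -/
theorem IsTorsionClass.of_elements (hT : IsTorsionClass T) [Module.Finite R N] (hM : T M)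
    (h : ∀ y : N, ∃ g : M →ₗ[R] N, y ∈ LinearMap.range g) : T N := by
  classical
  obtain ⟨s, hs⟩ := Module.Finite.fg_top (R := R) (M := N)
  choose g hg using h
  refine hT.of_iSup (ι := s) (X := fun _ => M) (fun _ => hM) (fun y => g y) ?_
  rw [eq_top_iff, ← hs, Submodule.span_le]
  intro y hy
  exact (le_iSup (fun y : s => LinearMap.range (g y)) ⟨y, hy⟩) (hg y)

theorem IsLeftApprox.hasApproxKernels {A : Type} [AddCommGroup A] [Module R A]
    {j : R →ₗ[R] A} [IsNoetherianRing R] (hT : IsTorsionClass T)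
    (hj : IsLeftApprox T j) : HasApproxKernels T (A × (A ⧸ LinearMap.range j)) := by
  intro N N' _ _ _ _ φ hN hlift
  have := hT.finite N hN
  refine hT.of_elements hj.1 fun y => ?_
  obtain ⟨κ, hκ⟩ := hj.2 hN (LinearMap.toSpanSingleton R N y.1)
  have hκ1 : κ (j 1) = y.1 := by
    have := LinearMap.congr_fun hκ 1
    simpa using this
  have hrange : LinearMap.range j ≤ LinearMap.ker (φ ∘ₗ κ) := by
    rintro _ ⟨x, rfl⟩
    have := LinearMap.congr_fun hκ x
    simp only [LinearMap.comp_apply, LinearMap.toSpanSingleton_apply] at this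
    simp [this]
  obtain ⟨l, hl⟩ := hlift ((LinearMap.range j).liftQ _ hrange ∘ₗ LinearMap.snd R _ _)
  let l' : A →ₗ[R] N := l ∘ₗ LinearMap.inr R _ _ ∘ₗ (LinearMap.range j).mkQ
  have hl' : ∀ x, φ (l' x) = φ (κ x) := fun x => by
    have := LinearMap.congr_fun hl (0, (LinearMap.range j).mkQ x)
    simpa [l'] using this
  refine ⟨(κ - l').codRestrict (LinearMap.ker φ) fun x => by simp [hl'], j 1, ?_⟩
  apply Subtype.ext
  have : (LinearMap.range j).mkQ (j 1) = 0 := by simp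
  change κ (j 1) - l (0, (LinearMap.range j).mkQ (j 1)) = y.1
  rw [this, hκ1]
  exact (congrArg (y.1 - ·) (map_zero l)).trans (sub_zero _)

end

end TwoPoint

namespace TwoPoint

open Function

section

variable (K : Type) [Field K] {R : Type} [Ring R] [Algebra K R]
variable {P P' Q N N' : Type} [AddCommGroup P] [Module R P] [AddCommGroup P'] [Module R P']
  [AddCommGroup Q] [Module R Q]
  [AddCommGroup N] [Module R N] [AddCommGroup N'] [Module R N']

/-- The scalar multiplication on homomorphisms of modules over a `K`-algebra. -/
@[reducible] def homModule : Module K (P →ₗ[R] N) where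
  smul k f :=
    { toFun x := algebraMap K R k • f x
      map_add' x y := by rw [map_add, smul_add]
      map_smul' r x := by
        rw [map_smul, ← mul_smul, Algebra.commutes, mul_smul]; rfl }
  one_smul f := by ext x; change algebraMap K R 1 • f x = f x; simp
  mul_smul a b f := by
    ext x
    change algebraMap K R (a * b) • f x = algebraMap K R a • algebraMap K R b • f x
    rw [map_mul, mul_smul]
  smul_zero a := by ext x; change algebraMap K R a • (0 : N) = 0; simp
  smul_add a f g := by
    ext x
    change algebraMap K R a • (f x + g x) = algebraMap K R a • f x + algebraMap K R a • g x
    rw [smul_add]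
  add_smul a b f := by
    ext x
    change algebraMap K R (a + b) • f x = algebraMap K R a • f x + algebraMap K R b • f x
    rw [map_add, add_smul]
  zero_smul f := by ext x; change algebraMap K R 0 • f x = 0; simp

attribute [local instance] homModule

theorem homModule_smul_apply (k : K) (f : P →ₗ[R] N) (x : P) :
    (k • f) x = algebraMap K R k • f x := rfl

/-- Postcomposition as a `K`-linear map. -/
def postcomp (P : Type) [AddCommGroup P] [Module R P] (f : N →ₗ[R] N') :
    (P →ₗ[R] N) →ₗ[K] (P →ₗ[R] N') where
  toFun g := f ∘ₗ g
  map_add' _ _ := LinearMap.comp_add _ _ _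
  map_smul' k g := by ext x; exact map_smul f _ _

/-- Precomposition as a `K`-linear map. -/
def precomp (N : Type) [AddCommGroup N] [Module R N] (f : P →ₗ[R] P') :
    (P' →ₗ[R] N) →ₗ[K] (P →ₗ[R] N) where
  toFun g := g ∘ₗ f
  map_add' _ _ := LinearMap.add_comp _ _ _
  map_smul' _ _ := rfl

theorem finite_hom [FiniteDimensional K R] [Module.Finite R P] [Module.Finite R N] :
    Module.Finite K (P →ₗ[R] N) := by
  let : Module K N := Module.compHom N (algebraMap K R)
  have : IsScalarTower K R N := ⟨fun k r x => by
    change (k • r) • x = algebraMap K R k • r • x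
    rw [Algebra.smul_def, mul_smul]⟩
  have : Module.Finite K N := Module.Finite.trans R N
  obtain ⟨s, hs⟩ := Module.Finite.fg_top (R := R) (M := P)
  let ev : (P →ₗ[R] N) →ₗ[K] (s → N) :=
    { toFun f x := f x
      map_add' f g := rfl
      map_smul' k f := rfl }
  refine Module.Finite.of_injective ev fun f g hfg => ?_
  refine LinearMap.ext_on hs fun x hx => congrFun hfg ⟨x, hx⟩

variable (R) in
/-- The dimension of the space of homomorphisms. -/
def hdim (P N : Type) [AddCommGroup P] [Module R P] [AddCommGroup N] [Module R N] : ℕ :=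
  Module.finrank K (P →ₗ[R] N)

theorem hdim_le_of_forall_exists [FiniteDimensional K R] [Module.Finite R P] [Module.Finite R N]
    (f : N →ₗ[R] N') (hf : ∀ g : P →ₗ[R] N', ∃ l : P →ₗ[R] N, f ∘ₗ l = g) :
    hdim K R P N' ≤ hdim K R P N := by
  have := finite_hom K (R := R) (P := P) (N := N)
  exact LinearMap.finrank_le_finrank_of_surjective (f := postcomp K P f) hf

theorem exists_comp_eq_of_hdim_le [FiniteDimensional K R] [Module.Finite R P] [Module.Finite R N']
    (f : N →ₗ[R] N') (hf : ∀ g : P →ₗ[R] N, f ∘ₗ g = 0 → g = 0)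
    (h : hdim K R P N' ≤ hdim K R P N) (g : P →ₗ[R] N') :
    ∃ l : P →ₗ[R] N, f ∘ₗ l = g := by
  have := finite_hom K (R := R) (P := P) (N := N')
  have hinj : Injective (postcomp K P f) := by
    rw [← LinearMap.ker_eq_bot, LinearMap.ker_eq_bot']
    exact hf
  have : Module.Finite K (P →ₗ[R] N) := Module.Finite.of_injective _ hinj
  have heq := le_antisymm h (LinearMap.finrank_le_finrank_of_injective hinj)
  exact (LinearMap.injective_iff_surjective_of_finrank_eq_finrank heq.symm).1 hinj g

theorem hdim_eq_zero_iff [FiniteDimensional K R] [Module.Finite R P] [Module.Finite R N] :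
    hdim K R P N = 0 ↔ ∀ f : P →ₗ[R] N, f = 0 := by
  have := finite_hom K (R := R) (P := P) (N := N)
  rw [hdim, Module.finrank_zero_iff]
  exact ⟨fun h f => Subsingleton.elim _ _, fun h => ⟨fun f g => by rw [h f, h g]⟩⟩

theorem hdim_congr_left (e : P ≃ₗ[R] P') : hdim K R P N = hdim K R P' N :=
  LinearEquiv.finrank_eq
    { precomp K N e.symm.toLinearMap with
      invFun := precomp K N e.toLinearMap
      left_inv := fun f => by ext x; exact congrArg f (e.symm_apply_apply x)
      right_inv := fun f => by ext x; exact congrArg f (e.apply_symm_apply x) }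

theorem hdim_pi [FiniteDimensional K R] [Module.Finite R N] {ι : Type} [Fintype ι]
    {X : ι → Type} [∀ i, AddCommGroup (X i)] [∀ i, Module R (X i)]
    [∀ i, Module.Finite R (X i)] : hdim K R (∀ i, X i) N = ∑ i, hdim K R (X i) N := by
  classical
  have := fun i => finite_hom K (R := R) (P := X i) (N := N)
  have e : ((∀ i, X i) →ₗ[R] N) ≃ₗ[K] (∀ i, X i →ₗ[R] N) :=
    { (LinearMap.lsum R X ℕ (M := N)).symm.toAddEquiv with
      map_smul' := fun k f => by ext i x; rfl }
  exact e.finrank_eq.trans (Module.finrank_pi_fintype K)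

theorem hdim_prod [FiniteDimensional K R] [Module.Finite R N] [Module.Finite R P]
    [Module.Finite R P'] : hdim K R (P × P') N = hdim K R P N + hdim K R P' N := by
  have := finite_hom K (R := R) (P := P) (N := N)
  have := finite_hom K (R := R) (P := P') (N := N)
  have e : ((P →ₗ[R] N) × (P' →ₗ[R] N)) ≃ₗ[K] (P × P' →ₗ[R] N) :=
    { (LinearMap.coprodEquiv ℕ (R := R) (M := P) (M₂ := P') (M₃ := N)).toAddEquiv with
      map_smul' := fun k f => by
        ext x <;> simp [homModule_smul_apply] }
  exact e.finrank_eq.symm.trans (Module.finrank_prod)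

/-- Exactness of `0 → Hom(X, N) → Hom(P₀, N) → Hom(P₁, N) → 0`, numerically. -/
theorem hdim_presentation [FiniteDimensional K R] [Module.Finite R N] [Module.Finite R P]
    {X : Type} [AddCommGroup X] [Module R X] {f : P' →ₗ[R] P} {g : P →ₗ[R] X}
    (hg : Surjective g) (hfg : LinearMap.range f = LinearMap.ker g)
    (h : ∀ u : P' →ₗ[R] N, ∃ v : P →ₗ[R] N, v ∘ₗ f = u) :
    hdim K R X N + hdim K R P' N = hdim K R P N := by
  have := finite_hom K (R := R) (P := P) (N := N)
  have hinj : Injective (precomp K N g) := fun a b hab => by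
    ext x
    obtain ⟨y, rfl⟩ := hg x
    exact LinearMap.congr_fun hab y
  have hker : LinearMap.ker (precomp K N f) = LinearMap.range (precomp K N g) := by
    ext u
    constructor
    · intro hu
      obtain ⟨u', hu'⟩ := exists_comp_eq_of_ker_le (g := u) hg (by
        rw [← hfg]
        rintro _ ⟨x, rfl⟩
        exact LinearMap.congr_fun hu x)
      exact ⟨u', hu'⟩
    · rintro ⟨u', rfl⟩
      refine LinearMap.ext fun x => ?_
      have : g (f x) = 0 := by
        rw [← LinearMap.mem_ker, ← hfg]; exact ⟨x, rfl⟩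
      exact (congrArg u' this).trans (map_zero u')
  have h1 := LinearMap.finrank_range_add_finrank_ker (precomp K N f)
  rw [hker, LinearMap.finrank_range_of_inj hinj,
    LinearMap.range_eq_top.2 (show Surjective (precomp K N f) from h), finrank_top] at h1
  rw [hdim, hdim, hdim, ← h1, add_comm]

variable (U : Type) [AddCommGroup U] [Module R U]

theorem exists_right_approx [FiniteDimensional K R] [Module.Finite R U] [Module.Finite R N] :
    ∃ (m : ℕ) (G : (Fin m → U) →ₗ[R] N), ∀ g : U →ₗ[R] N,
      ∃ φ : U →ₗ[R] (Fin m → U), G ∘ₗ φ = g := by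
  have := finite_hom K (R := R) (P := U) (N := N)
  obtain ⟨m, s, hs⟩ := Module.Finite.exists_fin (R := K) (M := U →ₗ[R] N)
  refine ⟨m, LinearMap.lsum R (fun _ => U) ℕ s, fun g => ?_⟩
  have hg : g ∈ Submodule.span K (Set.range s) := by rw [hs]; trivial
  obtain ⟨c, rfl⟩ := (Submodule.mem_span_range_iff_exists_fun K).1 hg
  refine ⟨LinearMap.pi fun i => c i • LinearMap.id, ?_⟩
  ext x
  simp [homModule_smul_apply]

theorem exists_left_approx_hom [FiniteDimensional K R] [Module.Finite R U] [Module.Finite R N] :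
    ∃ (m : ℕ) (G : U →ₗ[R] (Fin m → N)), ∀ g : U →ₗ[R] N,
      ∃ φ : (Fin m → N) →ₗ[R] N, φ ∘ₗ G = g := by
  have := finite_hom K (R := R) (P := U) (N := N)
  obtain ⟨m, s, hs⟩ := Module.Finite.exists_fin (R := K) (M := U →ₗ[R] N)
  refine ⟨m, LinearMap.pi s, fun g => ?_⟩
  have hg : g ∈ Submodule.span K (Set.range s) := by rw [hs]; trivial
  obtain ⟨c, rfl⟩ := (Submodule.mem_span_range_iff_exists_fun K).1 hg
  refine ⟨LinearMap.lsum R (fun _ => N) ℕ fun i => c i • LinearMap.id, ?_⟩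
  ext x
  simp [homModule_smul_apply]

variable {T : ModPred R}

theorem exists_left_approx [FiniteDimensional K R] {M : Type} [AddCommGroup M] [Module R M]
    (hT : IsTorsionClass T) (hM : T M) (hfac : ∀ (N : Type) [AddCommGroup N] [Module R N], T N →
      Fac (R := R) M N) [Module.Finite R Q] [Module.Projective R Q] :
    ∃ (m : ℕ) (G : Q →ₗ[R] (Fin m → M)), IsLeftApprox T G := by
  have : Module.Finite R M := hT.finite M hM
  obtain ⟨m, G, hG⟩ := exists_left_approx_hom K (R := R) (N := M) Q
  refine ⟨m, G, hT.pi fun _ => hM, fun {N} _ _ hN h => ?_⟩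
  obtain ⟨k, f, hf⟩ := hfac N hN
  obtain ⟨l, rfl⟩ := Module.projective_lifting_property f h hf
  choose φ hφ using fun i => hG (LinearMap.proj i ∘ₗ l)
  refine ⟨f ∘ₗ LinearMap.pi φ, ?_⟩
  rw [LinearMap.comp_assoc]
  congr 1
  ext x i
  exact LinearMap.congr_fun (hφ i) x

end

end TwoPoint

namespace TwoPoint

open Function

section

variable {R : Type} [Ring R] {T : ModPred R}
variable {P N Y X : Type} [AddCommGroup P] [Module R P] [AddCommGroup N] [Module R N]
  [AddCommGroup Y] [Module R Y] [AddCommGroup X] [Module R X]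

theorem exists_projective_cover [IsArtinianRing R] [Module.Finite R P] [Module.Projective R P]
    (g : P →ₗ[R] Y) :
    ∃ L Z : Submodule R P, IsCompl L Z ∧ Z ≤ LinearMap.ker g ∧
      ∀ L' ≤ L, L'.map g = ⊤ → L' = L := by
  obtain ⟨L, ⟨e, rfl, he⟩, hmin⟩ := wellFounded_lt.has_min
    {L : Submodule R P | ∃ e : P →ₗ[R] P, LinearMap.range e = L ∧ g ∘ₗ e = g}
    ⟨⊤, LinearMap.id, LinearMap.range_id, rfl⟩
  have hmin' : ∀ e' : P →ₗ[R] P, LinearMap.range e' ≤ LinearMap.range e → g ∘ₗ e' = g →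
      LinearMap.range e' = LinearMap.range e := fun e' h h' =>
    by_contra fun hne => hmin _ ⟨e', rfl, h'⟩ (lt_of_le_of_ne h hne)
  have hee : LinearMap.range (e ∘ₗ e) = LinearMap.range e :=
    hmin' _ (LinearMap.range_comp_le_range e e) (by rw [← LinearMap.comp_assoc, he, he])
  let e' : LinearMap.range e →ₗ[R] LinearMap.range e :=
    e.rangeRestrict ∘ₗ (LinearMap.range e).subtype
  have hs : Surjective e' := by
    rintro ⟨y, hy⟩
    rw [← hee] at hy
    obtain ⟨x, rfl⟩ := hy
    exact ⟨⟨e x, x, rfl⟩, rfl⟩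
  have hi := IsNoetherian.injective_of_surjective_endomorphism e' hs
  refine ⟨LinearMap.range e, LinearMap.ker e, IsCompl.of_eq ?_ ?_, fun x hx => ?_, fun L' hL' h => ?_⟩
  · rw [eq_bot_iff]
    rintro y ⟨hy, hy'⟩
    have : e' ⟨y, hy⟩ = e' 0 := by
      apply Subtype.ext
      rw [map_zero]
      exact hy'
    exact congrArg Subtype.val (hi this)
  · rw [eq_top_iff]
    rintro x -
    obtain ⟨y, hy⟩ : e x ∈ LinearMap.range (e ∘ₗ e) := by rw [hee]; exact ⟨x, rfl⟩
    refine Submodule.mem_sup.2 ⟨e y, ⟨y, rfl⟩, x - e y, ?_, by abel⟩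
    rw [LinearMap.mem_ker, map_sub, sub_eq_zero]
    exact hy.symm
  · rw [LinearMap.mem_ker, ← he, LinearMap.comp_apply, LinearMap.mem_ker.1 hx, map_zero]
  · have hs' : Surjective (g ∘ₗ L'.subtype) := by
      intro y
      have : y ∈ L'.map g := by rw [h]; trivial
      obtain ⟨x, hx, rfl⟩ := this
      exact ⟨⟨x, hx⟩, rfl⟩
    obtain ⟨l, hl⟩ := Module.projective_lifting_property _ g hs'
    have hle : LinearMap.range (L'.subtype ∘ₗ l) ≤ L' := by
      rintro _ ⟨x, rfl⟩
      exact (l x).2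
    exact le_antisymm hL' ((hmin' _ (hle.trans hL') hl).symm.le.trans hle)

theorem projective_of_isCompl [Module.Projective R P] {L Z : Submodule R P} (h : IsCompl L Z) :
    Module.Projective R L :=
  Module.Projective.of_split L.subtype (L.projectionOnto Z h) (by
    ext x
    simp)

/-- A finite projective presentation such that maps from `P₁` to objects of `T` extend to `P₀`. -/
structure IsPresentation (T : ModPred R) {P₁ P₀ X : Type} [AddCommGroup P₁] [Module R P₁]
    [AddCommGroup P₀] [Module R P₀] [AddCommGroup X] [Module R X]
    (f : P₁ →ₗ[R] P₀) (g : P₀ →ₗ[R] X) : Prop where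
  finite₁ : Module.Finite R P₁
  projective₁ : Module.Projective R P₁
  finite₀ : Module.Finite R P₀
  projective₀ : Module.Projective R P₀
  surjective : Surjective g
  range_eq : LinearMap.range f = LinearMap.ker g
  extends_along : ∀ (N : Type) [AddCommGroup N] [Module R N], T N → ∀ h : P₁ →ₗ[R] N,
    ∃ h' : P₀ →ₗ[R] N, h' ∘ₗ f = h

theorem LiftsAlong.extends_kernel (hT : IsTorsionClass T) (hX : LiftsAlong T X)
    {g : P →ₗ[R] X} (hg : Surjective g) (hN : T N) (u : LinearMap.ker g →ₗ[R] N) :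
    ∃ v : P →ₗ[R] N, v ∘ₗ (LinearMap.ker g).subtype = u := by
  let d : LinearMap.ker g →ₗ[R] N × P := u.prod (-(LinearMap.ker g).subtype)
  let D := LinearMap.range d
  have hD : D ≤ LinearMap.ker (g ∘ₗ LinearMap.snd R N P) := by
    rintro _ ⟨w, rfl⟩
    change g (-w.1) = 0
    rw [map_neg, LinearMap.mem_ker.1 w.2, neg_zero]
  let q : ((N × P) ⧸ D) →ₗ[R] X := D.liftQ _ hD
  have hqmk : ∀ z, q (D.mkQ z) = g z.2 := fun z => rfl
  have hq : Surjective q := fun x => by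
    obtain ⟨y, rfl⟩ := hg x
    exact ⟨D.mkQ (0, y), rfl⟩
  let i : N →ₗ[R] LinearMap.ker q := (D.mkQ ∘ₗ LinearMap.inl R N P).codRestrict _ fun n =>
    (hqmk _).trans (map_zero g)
  have hi : ∀ n, (i n).1 = D.mkQ (n, 0) := fun n => rfl
  have hsurj : Surjective i := by
    rintro ⟨z, hz⟩
    obtain ⟨⟨n, w⟩, rfl⟩ := D.mkQ_surjective z
    have hw : w ∈ LinearMap.ker g := hz
    refine ⟨n + u ⟨w, hw⟩, Subtype.ext ?_⟩
    rw [hi, ← sub_eq_zero, ← map_sub, Submodule.mkQ_apply, Submodule.Quotient.mk_eq_zero]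
    exact ⟨⟨w, hw⟩, by ext <;> simp [d]⟩
  have hinj : Injective i := by
    rw [← LinearMap.ker_eq_bot, LinearMap.ker_eq_bot']
    intro n hn
    have h1 : D.mkQ (n, 0) = 0 := (hi n).symm.trans (congrArg Subtype.val hn)
    rw [Submodule.mkQ_apply, Submodule.Quotient.mk_eq_zero] at h1
    obtain ⟨w, hw⟩ := h1
    have hw2 : -w.1 = 0 := congrArg Prod.snd hw
    have hw1 : u w = n := congrArg Prod.fst hw
    have : w = 0 := Subtype.ext (neg_eq_zero.1 hw2)
    rw [← hw1, this, map_zero]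
  let e := LinearEquiv.ofBijective i ⟨hinj, hsurj⟩
  obtain ⟨s, hs⟩ := hX q hq (hT.of_surjective i hsurj hN) LinearMap.id
  have hs' : ∀ x, q (s x) = x := LinearMap.congr_fun hs
  let c : P →ₗ[R] LinearMap.ker q :=
    (D.mkQ ∘ₗ LinearMap.inr R N P - s ∘ₗ g).codRestrict _ fun w => by
      change q (D.mkQ (0, w) - s (g w)) = 0
      rw [map_sub, hqmk, hs', sub_self]
  refine ⟨e.symm.toLinearMap ∘ₗ c, LinearMap.ext fun w => ?_⟩
  change e.symm (c w.1) = u w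
  rw [LinearEquiv.symm_apply_eq]
  apply Subtype.ext
  change D.mkQ (0, w.1) - s (g w.1) = D.mkQ (u w, 0)
  rw [LinearMap.mem_ker.1 w.2, map_zero, sub_zero, ← sub_eq_zero, ← map_sub,
    Submodule.mkQ_apply, Submodule.Quotient.mk_eq_zero]
  exact ⟨-w, by ext <;> simp [d]⟩

theorem LiftsAlong.exists_presentation [IsArtinianRing R] (hT : IsTorsionClass T)
    [Module.Finite R X] (hX : LiftsAlong T X) :
    ∃ (P₁ P₀ : Type) (_ : AddCommGroup P₁) (_ : Module R P₁) (_ : AddCommGroup P₀)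
      (_ : Module R P₀) (f : P₁ →ₗ[R] P₀) (g : P₀ →ₗ[R] X), IsPresentation T f g := by
  obtain ⟨n, g, hg⟩ := Module.Finite.exists_fin' R X
  obtain ⟨m, p, hp⟩ := Module.Finite.exists_fin' R (LinearMap.ker g)
  obtain ⟨L, Z, hLZ, hZ, hsmall⟩ := exists_projective_cover p
  let p' : L →ₗ[R] LinearMap.ker g := p ∘ₗ L.subtype
  have hp' : Surjective p' := by
    intro y
    obtain ⟨x, rfl⟩ := hp y
    obtain ⟨a, ha, b, hb, rfl⟩ := Submodule.mem_sup.1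
      (show x ∈ L ⊔ Z by rw [hLZ.sup_eq_top]; trivial)
    refine ⟨⟨a, ha⟩, ?_⟩
    rw [map_add, LinearMap.mem_ker.1 (hZ hb), add_zero]
    rfl
  have hsmall' : ∀ L' : Submodule R L, L'.map p' = ⊤ → L' = ⊤ := by
    intro L' h
    have := hsmall (L'.map L.subtype) (Submodule.map_subtype_le _ _)
      (by rw [← h, Submodule.map_comp])
    rw [eq_top_iff]
    rintro x -
    have hx : x.1 ∈ L'.map L.subtype := by rw [this]; exact x.2
    obtain ⟨y, hy, hyx⟩ := hx
    rwa [← Subtype.ext (a1 := y) hyx]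
  refine ⟨L, Fin n → R, inferInstance, inferInstance, inferInstance, inferInstance,
    (LinearMap.ker g).subtype ∘ₗ p', g, inferInstance, projective_of_isCompl hLZ, inferInstance,
    inferInstance, hg, ?_, fun N _ _ hN h => ?_⟩
  · rw [LinearMap.range_comp, LinearMap.range_eq_top.2 hp', Submodule.map_top,
      Submodule.range_subtype]
  have := hT.finite N hN
  have key : ∀ I : Submodule R N, ∀ h : L →ₗ[R] N, LinearMap.range h = I →
      ∃ h' : (Fin n → R) →ₗ[R] N, h' ∘ₗ ((LinearMap.ker g).subtype ∘ₗ p') = h := by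
    intro I
    induction I using (wellFounded_lt (α := Submodule R N)).induction with
    | h I ih =>
    intro h hI
    let N₁ := (LinearMap.ker p').map h
    obtain ⟨u, hu⟩ := exists_comp_eq_of_ker_le (g := N₁.mkQ ∘ₗ h) hp' (by
      intro x hx
      rw [LinearMap.mem_ker, LinearMap.comp_apply, Submodule.mkQ_apply,
        Submodule.Quotient.mk_eq_zero]
      exact ⟨x, hx, rfl⟩)
    obtain ⟨v, hv⟩ := hX.extends_kernel hT hg (hT.of_surjective N₁.mkQ N₁.mkQ_surjective hN) u
    obtain ⟨w, rfl⟩ := Module.projective_lifting_property N₁.mkQ v N₁.mkQ_surjective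
    have hw : LinearMap.range (h - w ∘ₗ (LinearMap.ker g).subtype ∘ₗ p') ≤ N₁ := by
      rintro _ ⟨x, rfl⟩
      rw [← Submodule.Quotient.mk_eq_zero, ← Submodule.mkQ_apply, LinearMap.sub_apply, map_sub,
        sub_eq_zero]
      exact (LinearMap.congr_fun hu x).symm.trans
        (LinearMap.congr_fun hv (p' x)).symm
    have hle : N₁ ≤ I := by
      rintro _ ⟨x, -, rfl⟩
      rw [← hI]; exact ⟨x, rfl⟩
    rcases eq_or_lt_of_le (hw.trans hle) with heq | hlt
    · have hN₁ : I ≤ N₁ := heq ▸ hw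
      have hk : LinearMap.ker h = ⊤ := by
        apply hsmall'
        rw [eq_top_iff]
        rintro y -
        obtain ⟨x, rfl⟩ := hp' y
        obtain ⟨k, hk, hkx⟩ : h x ∈ N₁ := hN₁ (hI ▸ ⟨x, rfl⟩)
        refine ⟨x - k, ?_, ?_⟩
        · rw [SetLike.mem_coe, LinearMap.mem_ker, map_sub, hkx, sub_self]
        · rw [map_sub, LinearMap.mem_ker.1 hk, sub_zero]
      exact ⟨0, by rw [LinearMap.zero_comp, LinearMap.ker_eq_top.1 hk]⟩
    · obtain ⟨w', hw'⟩ := ih _ hlt _ rfl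
      exact ⟨w + w', by rw [LinearMap.add_comp, hw']; abel⟩
  exact key _ h rfl

theorem IsPresentation.liftsAlong {P₁ P₀ : Type} [AddCommGroup P₁] [Module R P₁]
    [AddCommGroup P₀] [Module R P₀] {f : P₁ →ₗ[R] P₀} {g : P₀ →ₗ[R] X}
    (h : IsPresentation T f g) : LiftsAlong T X := by
  intro E Y _ _ _ _ q hq hk φ
  have := h.projective₀
  have hgf : ∀ x, g (f x) = 0 := fun x => by
    rw [← LinearMap.mem_ker, ← h.range_eq]; exact ⟨x, rfl⟩
  obtain ⟨l, hl⟩ := Module.projective_lifting_property q (φ ∘ₗ g) hq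
  have hl' : ∀ x, q (l x) = φ (g x) := LinearMap.congr_fun hl
  obtain ⟨v, hv⟩ := h.extends_along _ hk ((l ∘ₗ f).codRestrict (LinearMap.ker q) fun x => by
    rw [LinearMap.mem_ker, LinearMap.comp_apply, hl', hgf, map_zero])
  have hv' : ∀ x, (v (f x)).1 = l (f x) := fun x =>
    congrArg Subtype.val (LinearMap.congr_fun hv x)
  obtain ⟨w, hw⟩ := exists_comp_eq_of_ker_le (g := l - (LinearMap.ker q).subtype ∘ₗ v)
    h.surjective (by
      rw [← h.range_eq]
      rintro _ ⟨x, rfl⟩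
      rw [LinearMap.mem_ker, LinearMap.sub_apply, sub_eq_zero]
      exact (hv' x).symm)
  refine ⟨w, LinearMap.ext fun x => ?_⟩
  obtain ⟨y, rfl⟩ := h.surjective x
  have h1 : w (g y) = l y - (v y).1 := LinearMap.congr_fun hw y
  rw [LinearMap.comp_apply, h1, map_sub, hl', LinearMap.mem_ker.1 (v y).2, sub_zero]

/-- The properties of an `Ext`-projective generator of a torsion class. -/
structure IsExtGenerator (T : ModPred R) (U : Type) [AddCommGroup U] [Module R U] : Prop where
  finite : Module.Finite R U
  mem : T U
  lifts : LiftsAlong T U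
  kernels : HasApproxKernels T U
  fac : ∀ (N : Type) [AddCommGroup N] [Module R N], T N → Fac (R := R) U N

theorem fac_of_elements {M : Type} [AddCommGroup M] [Module R M] [Module.Finite R N]
    (h : ∀ y : N, ∃ g : M →ₗ[R] N, y ∈ LinearMap.range g) : Fac (R := R) M N := by
  obtain ⟨n, s, hs⟩ := Module.Finite.exists_fin (R := R) (M := N)
  choose g hg using h
  refine ⟨n, LinearMap.lsum R (fun _ => M) ℕ fun i => g (s i), ?_⟩
  rw [← LinearMap.range_eq_top, eq_top_iff, ← hs, Submodule.span_le]
  rintro _ ⟨i, rfl⟩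
  obtain ⟨x, hx⟩ := hg (s i)
  exact ⟨Pi.single i x, by rw [LinearMap.lsum_piSingle, hx]⟩

theorem IsTorsionClass.exists_extGenerator (K : Type) [Field K] [Algebra K R]
    [FiniteDimensional K R] [IsArtinianRing R] (hT : IsTorsionClass T)
    {M : Type} [AddCommGroup M] [Module R M] (hM : T M)
    (hfac : ∀ (N : Type) [AddCommGroup N] [Module R N], T N → Fac (R := R) M N) :
    ∃ (U : Type) (_ : AddCommGroup U) (_ : Module R U), IsExtGenerator T U := by
  obtain ⟨m, G, hG⟩ := exists_left_approx K (R := R) (Q := R) hT hM hfac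
  obtain ⟨L, j, hj, hmin⟩ := hG.exists_minimal hT
  have hL : LiftsAlong T L := hj.liftsAlong hT hmin
  have hU : T (L × (L ⧸ LinearMap.range j)) :=
    hT.prod hj.1 (hT.of_surjective _ (LinearMap.range j).mkQ_surjective hj.1)
  refine ⟨L × (L ⧸ LinearMap.range j), inferInstance, inferInstance, hT.finite _ hU, hU, hL.prod (hj.liftsAlong_coker hL),
    hj.hasApproxKernels hT, fun N _ _ hN => ?_⟩
  have := hT.finite N hN
  refine fac_of_elements fun y => ?_
  obtain ⟨κ, hκ⟩ := hj.2 hN (LinearMap.toSpanSingleton R N y)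
  refine ⟨κ ∘ₗ LinearMap.fst R _ _, (j 1, 0), ?_⟩
  have := LinearMap.congr_fun hκ 1
  simpa using this

variable {U : Type} [AddCommGroup U] [Module R U]

/-- Objects of `T` are covered by powers of `U`, with kernel in `T`. -/
theorem IsExtGenerator.exists_cover (K : Type) [Field K] [Algebra K R]
    [FiniteDimensional K R] (hT : IsTorsionClass T) (hU : IsExtGenerator T U) (hN : T N) :
    ∃ (m : ℕ) (G : (Fin m → U) →ₗ[R] N), Surjective G ∧ T (LinearMap.ker G) ∧
      ∀ g : U →ₗ[R] N, ∃ φ : U →ₗ[R] (Fin m → U), G ∘ₗ φ = g := by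
  have : Module.Finite R U := hU.finite
  have : Module.Finite R N := hT.finite N hN
  obtain ⟨m, G, hG⟩ := exists_right_approx K (R := R) (N := N) U
  refine ⟨m, G, ?_, hU.kernels G (hT.pi fun _ => hU.mem) hG, hG⟩
  obtain ⟨k, f, hf⟩ := hU.fac N hN
  choose φ hφ using fun i => hG (f ∘ₗ LinearMap.single R (fun _ => U) i)
  intro y
  obtain ⟨x, rfl⟩ := hf y
  refine ⟨LinearMap.lsum R (fun _ => U) ℕ φ x, ?_⟩
  have : G ∘ₗ LinearMap.lsum R (fun _ => U) ℕ φ = f :=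
    LinearMap.pi_ext' fun i => by
      rw [← hφ i]
      ext x
      have := LinearMap.lsum_piSingle (S := ℕ) (f := φ) (i := i) (x := x)
      exact congrArg G this
  exact LinearMap.congr_fun this x

/-- `Ext`-projective objects of `T` are retracts of powers of `U`. -/
theorem IsExtGenerator.exists_retract (K : Type) [Field K] [Algebra K R]
    [FiniteDimensional K R] (hT : IsTorsionClass T) (hU : IsExtGenerator T U) (hN : T N)
    (h : LiftsAlong T N) :
    ∃ (m : ℕ) (i : N →ₗ[R] (Fin m → U)) (r : (Fin m → U) →ₗ[R] N), r ∘ₗ i = LinearMap.id := by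
  obtain ⟨m, G, hG, hk, -⟩ := hU.exists_cover K hT hN
  obtain ⟨l, hl⟩ := h G hG hk LinearMap.id
  exact ⟨m, l, G, hl⟩

end

end TwoPoint

namespace TwoPoint

open Function

/-- A finitely generated module without nonzero maps to a simple module `S` is fixed by the
annihilator of `S`. -/
theorem annihilator_smul_top_eq_top {A S H : Type} [Ring A] [IsArtinianRing A] [AddCommGroup S]
    [Module A S] [IsSimpleModule A S] [AddCommGroup H] [Module A H] [Module.Finite A H]
    (h : ∀ f : H →ₗ[A] S, f = 0) : Module.annihilator A S • (⊤ : Submodule A H) = ⊤ := by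
  classical
  by_contra hne
  obtain ⟨L, hL, hle⟩ := (eq_top_or_exists_le_coatom _).resolve_left hne
  have hsimple : IsSimpleModule A (H ⧸ L) := isSimpleModule_iff_isCoatom.2 hL
  obtain ⟨_, ⟨F, rfl⟩, hF⟩ := wellFounded_lt.has_min
    {I : Ideal A | ∃ F : Finset S, I = F.inf fun s => LinearMap.ker (LinearMap.toSpanSingleton A S s)}
    ⟨_, ∅, rfl⟩
  have hann : ∀ a ∈ F.inf fun s => LinearMap.ker (LinearMap.toSpanSingleton A S s),
      a ∈ Module.annihilator A S := by
    intro a ha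
    rw [Module.mem_annihilator]
    intro s
    have h1 := hF _ ⟨insert s F, rfl⟩
    rw [Finset.inf_insert] at h1
    have h2 := eq_of_le_of_not_lt inf_le_right h1
    rw [← h2] at ha
    exact ha.1
  let θ : A →ₗ[A] (F → S) := LinearMap.pi fun s => LinearMap.toSpanSingleton A S s.1
  have := IsSimpleModule.nontrivial A (H ⧸ L)
  obtain ⟨v, hv⟩ := exists_ne (0 : H ⧸ L)
  let ev : A →ₗ[A] H ⧸ L := LinearMap.toSpanSingleton A _ v
  have hker : LinearMap.ker θ ≤ LinearMap.ker ev := by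
    intro a ha
    have haI : a ∈ Module.annihilator A S := by
      apply hann
      rw [Submodule.mem_finsetInf]
      intro s hs
      exact congrFun ha ⟨s, hs⟩
    obtain ⟨y, rfl⟩ := L.mkQ_surjective v
    change a • L.mkQ y = 0
    rw [← map_smul, Submodule.mkQ_apply, Submodule.Quotient.mk_eq_zero]
    exact hle (Submodule.smul_mem_smul haI trivial)
  obtain ⟨e, he⟩ := exists_comp_eq_of_ker_le (f := θ.rangeRestrict) (g := ev)
    θ.surjective_rangeRestrict (by rwa [LinearMap.ker_rangeRestrict])
  obtain ⟨e', he'⟩ := IsSemisimpleModule.extension_property (LinearMap.range θ).subtype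
    (Submodule.injective_subtype _) e
  have hne' : e' ≠ 0 := by
    rintro rfl
    apply hv
    have h1 := LinearMap.congr_fun he 1
    rw [← he'] at h1
    have h2 : ev 1 = v := one_smul _ _
    rw [← h2, ← h1]
    rfl
  obtain ⟨s, hs⟩ : ∃ s, e' ∘ₗ LinearMap.single A (fun _ : F => S) s ≠ 0 := by
    by_contra! hc
    exact hne' (LinearMap.pi_ext' fun s => by rw [hc s, LinearMap.zero_comp])
  have hb := (LinearMap.bijective_or_eq_zero _).resolve_right hs
  let i := LinearEquiv.ofBijective _ hb
  obtain ⟨y, hy⟩ := L.mkQ_surjective v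
  have h0 := LinearMap.congr_fun (h (i.symm.toLinearMap ∘ₗ L.mkQ)) y
  apply hv
  rw [← hy, ← i.symm.map_eq_zero_iff]
  exact h0

section

variable {R : Type} [Ring R] {T T' : ModPred R}
variable {U : Type} [AddCommGroup U] [Module R U] {N : Type} [AddCommGroup N] [Module R N]

theorem Fac.exists_ne_zero {B : Type} [AddCommGroup B] [Module R B] [Nontrivial B]
    (h : Fac (R := R) U B) : ∃ f : U →ₗ[R] B, f ≠ 0 := by
  obtain ⟨k, f, hf⟩ := h
  by_contra! hc
  have : f = 0 := LinearMap.pi_ext' fun i => by rw [hc (f ∘ₗ _), LinearMap.zero_comp]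
  obtain ⟨y, hy⟩ := exists_ne (0 : B)
  obtain ⟨x, rfl⟩ := hf y
  exact hy (by rw [this]; rfl)

theorem Fac.le_of_forall {B : Type} [AddCommGroup B] [Module R B]
    (h : Fac (R := R) U B) (L : Submodule R B) (hL : ∀ f : U →ₗ[R] B, LinearMap.range f ≤ L) :
    L = ⊤ := by
  classical
  obtain ⟨k, f, hf⟩ := h
  rw [eq_top_iff, ← LinearMap.range_eq_top.2 hf, LinearMap.range_eq_map,
    ← LinearMap.iSup_range_single R fun _ : Fin k => U, Submodule.map_iSup]
  refine iSup_le fun i => ?_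
  rw [← LinearMap.range_comp]
  exact hL _

variable (K : Type) [Field K] [Algebra K R] [FiniteDimensional K R]

include K in
theorem fac_of_iSup_eq_top [Module.Finite R U] [Module.Finite R N]
    (h : ⨆ g : U →ₗ[R] N, LinearMap.range g = ⊤) : Fac (R := R) U N := by
  obtain ⟨m, G, hG⟩ := exists_right_approx K (R := R) (N := N) U
  refine ⟨m, G, ?_⟩
  rw [← LinearMap.range_eq_top, eq_top_iff, ← h]
  refine iSup_le fun g => ?_
  obtain ⟨φ, rfl⟩ := hG g
  exact LinearMap.range_comp_le_range _ _

/-- A nonzero object of `T` receiving no maps from `T'`, with `Hom(U, B)` as small as possible. -/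
structure IsBrick (T T' : ModPred R) (U B : Type) [AddCommGroup U] [Module R U] [AddCommGroup B]
    [Module R B] : Prop where
  mem : T B
  nontrivial : Nontrivial B
  orthogonal : ∀ (N : Type) [AddCommGroup N] [Module R N], T' N → ∀ f : N →ₗ[R] B, f = 0
  surjective : ∀ (N : Type) [AddCommGroup N] [Module R N], T N → ∀ f : N →ₗ[R] B, f ≠ 0 →
    Surjective f ∧ T (LinearMap.ker f)

include K in
theorem exists_isBrick [IsArtinianRing R] (hT : IsTorsionClass T) (hT' : IsTorsionClass T')
    (hU : IsExtGenerator T U)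
    (hle : ∀ (N : Type) [AddCommGroup N] [Module R N], T' N → T N)
    (hN : T N) (hN' : ¬ T' N) :
    ∃ (B : Type) (_ : AddCommGroup B) (_ : Module R B), IsBrick T T' U B := by
  have : Module.Finite R U := hU.finite
  have hex : ∃ n : ℕ, ∃ (B : Type) (_ : AddCommGroup B) (_ : Module R B), T B ∧ Nontrivial B ∧
      (∀ (N : Type) [AddCommGroup N] [Module R N], T' N → ∀ f : N →ₗ[R] B, f = 0) ∧
      hdim K R U B = n := by
    have : Module.Finite R N := hT.finite N hN
    obtain ⟨t, -, ht, hmax⟩ := hT'.exists_maximal_sub (⊤ : Submodule R N)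
    refine ⟨_, N ⧸ t, inferInstance, inferInstance,
      hT.of_surjective t.mkQ t.mkQ_surjective hN, ?_, fun W _ _ hW f => ?_, rfl⟩
    · rw [Submodule.Quotient.nontrivial_iff]
      rintro rfl
      exact hN' (hT'.of_equiv Submodule.topEquiv ht)
    · refine hT'.eq_zero_of_maximal_sub le_top ht hmax hW f ?_
      rw [Submodule.map_top, Submodule.range_mkQ]
      exact le_top
  classical
  obtain ⟨B, _, _, hB, hnt, horth, hBdim⟩ := Nat.find_spec hex
  have hmin : ∀ (C : Type) [AddCommGroup C] [Module R C], T C → Nontrivial C →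
      (∀ (N : Type) [AddCommGroup N] [Module R N], T' N → ∀ f : N →ₗ[R] C, f = 0) →
      hdim K R U B ≤ hdim K R U C := fun C _ _ h1 h2 h3 => by
    rw [hBdim]
    exact Nat.find_min' hex ⟨C, _, _, h1, h2, h3, rfl⟩
  have : Module.Finite R B := hT.finite B hB
  refine ⟨B, _, _, hB, hnt, horth, fun N _ _ hN f hf => ?_⟩
  have : Module.Finite R N := hT.finite N hN
  constructor
  · rw [← LinearMap.range_eq_top]
    refine (hU.fac B hB).le_of_forall _ fun g => ?_
    have hle := hmin (LinearMap.range f) (hT.range f hN) ?_ fun W _ _ hW u => ?_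
    · obtain ⟨l, rfl⟩ := exists_comp_eq_of_hdim_le K (LinearMap.range f).subtype (fun u hu => by
        ext x
        exact LinearMap.congr_fun hu x) hle g
      rintro _ ⟨x, rfl⟩
      exact (l x).2
    · by_contra hc
      rw [not_nontrivial_iff_subsingleton, Submodule.subsingleton_iff_eq_bot,
        LinearMap.range_eq_bot] at hc
      exact hf hc
    · have := horth W hW ((LinearMap.range f).subtype ∘ₗ u)
      ext x
      exact LinearMap.congr_fun this x
  · obtain ⟨t, htk, ht, hmax⟩ := hT.exists_maximal_sub (LinearMap.ker f)
    let g := t.liftQ f htk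
    have hgmk : ∀ x, g (t.mkQ x) = f x := fun x => rfl
    have hker : LinearMap.ker g ≤ (LinearMap.ker f).map t.mkQ := by
      intro x hx
      obtain ⟨y, rfl⟩ := t.mkQ_surjective x
      exact ⟨y, hx, rfl⟩
    have hzero : ∀ (W : Type) [AddCommGroup W] [Module R W], T W → ∀ u : W →ₗ[R] N ⧸ t,
        g ∘ₗ u = 0 → u = 0 := fun W _ _ hW u hu => by
      refine hT.eq_zero_of_maximal_sub htk ht hmax hW u (le_trans ?_ hker)
      rintro _ ⟨x, rfl⟩
      exact LinearMap.congr_fun hu x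
    have hTq : T (N ⧸ t) := hT.of_surjective t.mkQ t.mkQ_surjective hN
    have hle := hmin (N ⧸ t) hTq ?_ fun W _ _ hW u => hzero W (hle W hW) u (horth W hW _)
    · have hk := hU.kernels g hTq
        (exists_comp_eq_of_hdim_le K g (fun u => hzero U hU.mem u) hle)
      have h0 := hzero _ hk (LinearMap.ker g).subtype (by ext x; exact x.2)
      have : t = LinearMap.ker f := by
        refine le_antisymm htk fun x hx => ?_
        have := LinearMap.congr_fun h0 ⟨t.mkQ x, hx⟩
        simpa using this
      rwa [← this]
    · by_contra hc
      rw [not_nontrivial_iff_subsingleton, Submodule.Quotient.subsingleton_iff] at hc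
      apply hf
      rw [← LinearMap.ker_eq_top, eq_top_iff, ← hc]
      exact htk

end

end TwoPoint

namespace TwoPoint

open Function

section

variable (K : Type) [Field K] {R : Type} [Ring R] [Algebra K R] [FiniteDimensional K R]
variable {T T' : ModPred R}
variable {U : Type} [AddCommGroup U] [Module R U] {N : Type} [AddCommGroup N] [Module R N]

/-- `Hom(U, N)` as a right module over the endomorphism ring of `U`. -/
@[reducible]
def endOpModule : Module (Module.End R U)ᵐᵒᵖ (U →ₗ[R] N) where
  smul a f := f ∘ₗ a.unop
  one_smul _ := rfl
  mul_smul _ _ _ := rfl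
  smul_zero _ := LinearMap.zero_comp _
  smul_add _ _ _ := LinearMap.add_comp _ _ _
  add_smul _ _ _ := LinearMap.comp_add _ _ _
  zero_smul _ := LinearMap.comp_zero _

attribute [local instance] endOpModule

theorem endOp_smul_apply (a : (Module.End R U)ᵐᵒᵖ) (f : U →ₗ[R] N) (x : U) :
    (a • f) x = f (a.unop x) := rfl

include K in
theorem isArtinianRing_endOp [Module.Finite R U] : IsArtinianRing (Module.End R U)ᵐᵒᵖ := by
  let i₁ : Module K (Module.End R U) := homModule K (P := U) (N := U)
  have h₁ : Module.Finite K (Module.End R U) := finite_hom K (R := R) (P := U) (N := U)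
  let i₂ : Algebra K (Module.End R U) := Algebra.ofModule
    (fun k a b => by
      refine LinearMap.ext fun x => ?_
      rfl)
    (fun k a b => by
      refine LinearMap.ext fun x => ?_
      exact LinearMap.map_smul a _ _)
  have : Module.Finite K (Module.End R U)ᵐᵒᵖ :=
    Module.Finite.equiv (MulOpposite.opLinearEquiv K)
  exact IsArtinianRing.of_finite K _

variable (N) in
include K in
theorem finite_hom_endOp [Module.Finite R U] [Module.Finite R N] :
    Module.Finite (Module.End R U)ᵐᵒᵖ (U →ₗ[R] N) := by
  classical
  obtain ⟨m, G, hG⟩ := exists_right_approx K (R := R) (N := N) U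
  refine ⟨⟨Finset.univ.image fun i => G ∘ₗ LinearMap.single R (fun _ => U) i, ?_⟩⟩
  rw [eq_top_iff]
  rintro g -
  obtain ⟨φ, rfl⟩ := hG g
  have : G ∘ₗ φ = ∑ i, (MulOpposite.op (LinearMap.proj i ∘ₗ φ : Module.End R U)) •
      (G ∘ₗ LinearMap.single R (fun _ => U) i) := by
    ext x
    rw [LinearMap.sum_apply]
    simp only [endOp_smul_apply, MulOpposite.unop_op, LinearMap.comp_apply,
      LinearMap.proj_apply]
    rw [← map_sum]
    congr 1
    exact (LinearMap.sum_single_apply (fun _ => U) (φ x)).symm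
  rw [this]
  exact Submodule.sum_mem _ fun i _ => Submodule.smul_mem _ _ (Submodule.subset_span (by simp))

include K in
/-- The functor `Hom(U, -)` is full on `T`. -/
theorem IsExtGenerator.hom_eq_zero (hT : IsTorsionClass T) (hU : IsExtGenerator T U) (hN : T N)
    {B : Type} [AddCommGroup B] [Module R B] (h : ∀ t : N →ₗ[R] B, t = 0)
    (θ : (U →ₗ[R] N) →ₗ[(Module.End R U)ᵐᵒᵖ] (U →ₗ[R] B)) : θ = 0 := by
  classical
  obtain ⟨m, G, hGs, hk, hG⟩ := hU.exists_cover K hT hN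
  let t₀ : (Fin m → U) →ₗ[R] B :=
    LinearMap.lsum R (fun _ => U) ℕ fun i => θ (G ∘ₗ LinearMap.single R (fun _ => U) i)
  have hcomp : ∀ w : U →ₗ[R] (Fin m → U), t₀ ∘ₗ w = θ (G ∘ₗ w) := by
    intro w
    have h1 : G ∘ₗ w = ∑ i, (MulOpposite.op (LinearMap.proj i ∘ₗ w : Module.End R U)) •
        (G ∘ₗ LinearMap.single R (fun _ => U) i) := by
      ext x
      rw [LinearMap.sum_apply]
      simp only [endOp_smul_apply, MulOpposite.unop_op, LinearMap.comp_apply,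
        LinearMap.proj_apply]
      rw [← map_sum]
      congr 1
      exact (LinearMap.sum_single_apply (fun _ => U) (w x)).symm
    rw [h1, map_sum]
    ext x
    rw [LinearMap.sum_apply]
    simp only [map_smul, endOp_smul_apply, MulOpposite.unop_op]
    simp [t₀]
  have hker : LinearMap.ker G ≤ LinearMap.ker t₀ := by
    have hfac := hU.fac _ hk
    have := hfac.le_of_forall ((LinearMap.ker t₀).comap (LinearMap.ker G).subtype) (fun f => by
      rintro _ ⟨x, rfl⟩
      have h1 := hcomp ((LinearMap.ker G).subtype ∘ₗ f)
      have h2 : G ∘ₗ (LinearMap.ker G).subtype ∘ₗ f = 0 := by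
        ext x
        exact (f x).2
      rw [h2, map_zero] at h1
      exact LinearMap.congr_fun h1 x)
    intro z hz
    exact (this.symm ▸ trivial :
      (⟨z, hz⟩ : LinearMap.ker G) ∈ (LinearMap.ker t₀).comap (LinearMap.ker G).subtype)
  obtain ⟨t, ht⟩ := exists_comp_eq_of_ker_le hGs hker
  ext1 g
  obtain ⟨φ, rfl⟩ := hG g
  rw [← hcomp, ← ht, h t]
  rfl

theorem IsBrick.isSimpleModule {B : Type} [AddCommGroup B] [Module R B]
    (hU : IsExtGenerator T U) (hB : IsBrick T T' U B) :
    IsSimpleModule (Module.End R U)ᵐᵒᵖ (U →ₗ[R] B) := by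
  rw [isSimpleModule_iff_toSpanSingleton_surjective]
  have := hB.nontrivial
  obtain ⟨f, hf⟩ := (hU.fac B hB.mem).exists_ne_zero
  refine ⟨⟨f, 0, hf⟩, fun f hf g => ?_⟩
  obtain ⟨hs, hk⟩ := hB.surjective U hU.mem f hf
  obtain ⟨φ, rfl⟩ := hU.lifts f hs hk g
  exact ⟨MulOpposite.op (φ : Module.End R U), rfl⟩

include K in
/-- The torsion class of objects of `T` left orthogonal to a brick has a generator. -/
theorem IsBrick.exists_generator {B : Type} [AddCommGroup B] [Module R B]
    (hT : IsTorsionClass T) (hU : IsExtGenerator T U) (hB : IsBrick T T' U B) :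
    ∃ W : Submodule R U, T W ∧ (∀ f : W →ₗ[R] B, f = 0) ∧
      ∀ (N : Type) [AddCommGroup N] [Module R N], T N → (∀ f : N →ₗ[R] B, f = 0) →
        Fac (R := R) W N := by
  have : Module.Finite R U := hU.finite
  have : IsArtinianRing R := IsArtinianRing.of_finite K R
  have : IsArtinianRing (Module.End R U)ᵐᵒᵖ := isArtinianRing_endOp K
  have : IsSimpleModule (Module.End R U)ᵐᵒᵖ (U →ₗ[R] B) := hB.isSimpleModule hU
  let A := (Module.End R U)ᵐᵒᵖ
  obtain ⟨J, ⟨hJI, hJ⟩, hmin⟩ := wellFounded_lt.has_min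
    {J : Ideal A | J ≤ Module.annihilator A (U →ₗ[R] B) ∧
      ∀ (N : Type) [AddCommGroup N] [Module R N], T N → (∀ f : N →ₗ[R] B, f = 0) →
        J • (⊤ : Submodule A (U →ₗ[R] N)) = ⊤}
    ⟨_, le_rfl, fun N _ _ hN h => by
      have : Module.Finite R N := hT.finite N hN
      have : Module.Finite A (U →ₗ[R] N) := finite_hom_endOp K N
      exact annihilator_smul_top_eq_top (hU.hom_eq_zero K hT hN h)⟩
  have hJJ : J • J = J := by
    have hle : J • J ≤ J := Submodule.smul_le_right
    refine eq_of_le_of_not_lt hle (hmin _ ⟨hle.trans hJI, fun N _ _ hN h => ?_⟩)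
    rw [Submodule.smul_assoc, hJ N hN h, hJ N hN h]
  let E : A → (U →ₗ[R] U) := fun a => a.unop
  let W : Submodule R U := ⨆ a : J, LinearMap.range (E a.1)
  have hEW : ∀ a ∈ J, ∀ x, E a x ∈ W := fun a ha x =>
    le_iSup (fun a : J => LinearMap.range (E a.1)) ⟨a, ha⟩ ⟨x, rfl⟩
  have hTW : T W := by
    obtain ⟨t, htW, ht, hmax⟩ := hT.exists_maximal_sub W
    have : W ≤ t := iSup_le fun a => hmax _
      (le_iSup (fun a : J => LinearMap.range (E a.1)) a) (hT.range _ hU.mem)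
    rwa [← le_antisymm htW this]
  have : Module.Finite R W := hT.finite W hTW
  refine ⟨W, hTW, fun f => ?_, fun N _ _ hN h => ?_⟩
  · have key : ∀ a ∈ J, ∃ a' : U →ₗ[R] W, (∀ x, (a' x).1 = E a x) ∧ f ∘ₗ a' = 0 := by
      intro a ha
      rw [← hJJ] at ha
      refine Submodule.smul_induction_on (p := fun a => ∃ a' : U →ₗ[R] W,
        (∀ x, (a' x).1 = E a x) ∧ f ∘ₗ a' = 0) ha (fun r hr n hn => ?_) ?_
      · let n' : U →ₗ[R] W := (E n).codRestrict W (hEW n hn)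
        refine ⟨n' ∘ₗ E r, fun x => rfl, ?_⟩
        exact Module.mem_annihilator.1 (hJI hr) (f ∘ₗ n')
      · rintro x y ⟨a, ha, ha'⟩ ⟨b, hb, hb'⟩
        refine ⟨a + b, fun z => ?_, by rw [LinearMap.comp_add, ha', hb', add_zero]⟩
        exact congrArg₂ (· + ·) (ha z) (hb z)
    have hW : W ≤ (LinearMap.ker f).map W.subtype := by
      refine iSup_le ?_
      rintro ⟨a, ha⟩ _ ⟨x, rfl⟩
      obtain ⟨a', h1, h2⟩ := key a ha
      exact ⟨a' x, LinearMap.congr_fun h2 x, h1 x⟩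
    ext x
    obtain ⟨y, hy, hyx⟩ := hW x.2
    rwa [← Subtype.ext (a1 := y) hyx]
  · have : Module.Finite R N := hT.finite N hN
    refine fac_of_iSup_eq_top K ?_
    refine (hU.fac N hN).le_of_forall _ fun g => ?_
    have hg : g ∈ J • (⊤ : Submodule A (U →ₗ[R] N)) := by rw [hJ N hN h]; trivial
    refine Submodule.smul_induction_on (p := fun g : U →ₗ[R] N => LinearMap.range g ≤
      ⨆ g : W →ₗ[R] N, LinearMap.range g) hg (fun a ha n _ => ?_) fun x y hx hy => ?_
    · rintro _ ⟨x, rfl⟩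
      exact le_iSup (fun g : W →ₗ[R] N => LinearMap.range g) (n ∘ₗ W.subtype)
        ⟨⟨E a x, hEW a ha x⟩, rfl⟩
    · rintro _ ⟨z, rfl⟩
      exact add_mem (hx ⟨z, rfl⟩) (hy ⟨z, rfl⟩)

include K in
/-- Below a torsion class with a generator, every smaller torsion class is contained in a strictly
smaller one with a generator. -/
theorem IsExtGenerator.exists_between (hT : IsTorsionClass T) (hT' : IsTorsionClass T')
    (hU : IsExtGenerator T U)
    (hle : ∀ (N : Type) [AddCommGroup N] [Module R N], T' N → T N) (hN : T N) (hN' : ¬ T' N) :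
    ∃ T₁ : ModPred R, IsTorsionClass T₁ ∧
      (∀ (N : Type) [AddCommGroup N] [Module R N], T' N → T₁ N) ∧
      (∀ (N : Type) [AddCommGroup N] [Module R N], T₁ N → T N) ∧
      (∃ (B : Type) (_ : AddCommGroup B) (_ : Module R B), T B ∧ ¬ T₁ B) ∧
      ∃ (V : Type) (_ : AddCommGroup V) (_ : Module R V), IsExtGenerator T₁ V := by
  have : IsArtinianRing R := IsArtinianRing.of_finite K R
  obtain ⟨B, _, _, hB⟩ := exists_isBrick K hT hT' hU hle hN hN'
  obtain ⟨W, hW, hWB, hfac⟩ := hB.exists_generator K hT hU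
  have hT₁ := hT.inf_orthogonal B
  refine ⟨_, hT₁, fun N _ _ h => ⟨hle N h, hB.orthogonal N h⟩, fun N _ _ h => h.1,
    ⟨B, _, _, hB.mem, fun h => ?_⟩,
    hT₁.exists_extGenerator K (M := W) ⟨hW, hWB⟩ fun N _ _ h => hfac N h.1 h.2⟩
  have := hB.nontrivial
  obtain ⟨b, hb⟩ := exists_ne (0 : B)
  exact hb (LinearMap.congr_fun (h.2 LinearMap.id) b)

end

end TwoPoint

namespace TwoPoint

open Function

/-- `Z` is isomorphic to a direct summand of `Y`. -/
def IsRetract (R : Type) [Ring R] (Z Y : Type) [AddCommGroup Z] [Module R Z] [AddCommGroup Y]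
    [Module R Y] : Prop :=
  ∃ (i : Z →ₗ[R] Y) (r : Y →ₗ[R] Z), r ∘ₗ i = LinearMap.id

section

variable {R : Type} [Ring R]
variable {X Y Z : Type} [AddCommGroup X] [Module R X] [AddCommGroup Y] [Module R Y]
  [AddCommGroup Z] [Module R Z]

theorem IsRetract.trans (h : IsRetract R X Y) (h' : IsRetract R Y Z) : IsRetract R X Z := by
  obtain ⟨i, r, h⟩ := h
  obtain ⟨i', r', h'⟩ := h'
  refine ⟨i' ∘ₗ i, r ∘ₗ r', ?_⟩
  rw [LinearMap.comp_assoc, ← LinearMap.comp_assoc i i' r', h', LinearMap.id_comp, h]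

theorem IsRetract.of_equiv (e : X ≃ₗ[R] Y) : IsRetract R X Y :=
  ⟨e.toLinearMap, e.symm.toLinearMap, by ext; simp⟩

theorem IsRetract.of_isCompl {N₁ N₂ : Submodule R X} (h : IsCompl N₁ N₂) : IsRetract R N₁ X :=
  ⟨N₁.subtype, N₁.projectionOnto N₂ h, by ext; simp⟩

theorem IsRetract.of_pi {ι : Type} [DecidableEq ι] {Y : ι → Type} [∀ i, AddCommGroup (Y i)]
    [∀ i, Module R (Y i)] (i : ι) : IsRetract R (Y i) (∀ i, Y i) :=
  ⟨LinearMap.single R Y i, LinearMap.proj i, by ext; simp⟩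

theorem IsRetract.of_bijective (f : X →ₗ[R] Y) (g : Y →ₗ[R] X) (h : Bijective (g ∘ₗ f)) :
    IsRetract R X Y := by
  refine ⟨f, (LinearEquiv.ofBijective _ h).symm.toLinearMap ∘ₗ g, ?_⟩
  ext x
  exact (LinearEquiv.ofBijective _ h).symm_apply_apply x

theorem IsRetract.finite [Module.Finite R Y] (h : IsRetract R X Y) : Module.Finite R X := by
  obtain ⟨i, r, h⟩ := h
  exact Module.Finite.of_surjective r fun x => ⟨i x, LinearMap.congr_fun h x⟩

theorem IsRetract.projective [Module.Projective R Y] (h : IsRetract R X Y) :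
    Module.Projective R X := by
  obtain ⟨i, r, h⟩ := h
  exact Module.Projective.of_split i r h

theorem IsIndecModule.of_equiv (h : IsIndecModule R X) (e : X ≃ₗ[R] Y) : IsIndecModule R Y := by
  have := h.1
  refine ⟨e.symm.toEquiv.nontrivial, fun N₁ N₂ hN => ?_⟩
  have := h.2 _ _ (hN.map (Submodule.orderIsoMapComap e.symm))
  simpa using this

/-- A nonzero direct summand of an indecomposable module is the whole module. -/
theorem IsRetract.nonempty_equiv (h : IsRetract R X Y) [Nontrivial X] (hY : IsIndecModule R Y) :
    Nonempty (X ≃ₗ[R] Y) := by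
  obtain ⟨i, r, h⟩ := h
  have hinj : Injective i := fun a b hab => by
    rw [← LinearMap.id_apply (R := R) a, ← LinearMap.id_apply (R := R) b, ← h]
    simp [hab]
  have hcompl : IsCompl (LinearMap.range i) (LinearMap.ker r) := by
    constructor
    · rw [disjoint_iff, eq_bot_iff]
      rintro _ ⟨⟨x, rfl⟩, hx⟩
      have : x = 0 := by
        rw [← LinearMap.id_apply (R := R) x, ← h]
        exact hx
      simp [this]
    · rw [codisjoint_iff, eq_top_iff]
      rintro y -
      refine Submodule.mem_sup.2 ⟨i (r y), ⟨_, rfl⟩, y - i (r y), ?_, by abel⟩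
      have := LinearMap.congr_fun h (r y)
      simp only [LinearMap.comp_apply, LinearMap.id_apply] at this
      simp [this]
  rcases hY.2 _ _ hcompl with h0 | h0
  · exfalso
    obtain ⟨x, hx⟩ := exists_ne (0 : X)
    refine hx (hinj ?_)
    rw [map_zero]
    exact (Submodule.mem_bot R).1 (h0 ▸ ⟨x, rfl⟩)
  · refine ⟨LinearEquiv.ofBijective i ⟨hinj, LinearMap.range_eq_top.1 ?_⟩⟩
    have := hcompl.sup_eq_top
    rwa [h0, sup_bot_eq] at this

theorem IsIndecModule.bijective_or_isNilpotent [IsArtinianRing R] [Module.Finite R X]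
    (hX : IsIndecModule R X) (f : Module.End R X) : Bijective f ∨ IsNilpotent f := by
  obtain ⟨n, hn⟩ := Filter.eventually_atTop.1 f.eventually_isCompl_ker_pow_range_pow
  have hc := hn (n + 1) (Nat.le_succ n)
  rcases hX.2 _ _ hc with h | h
  · left
    have hinj : Injective f := by
      have := LinearMap.ker_eq_bot.1 h
      rw [pow_succ] at this
      exact Injective.of_comp (f := ⇑(f ^ n)) this
    exact IsArtinian.bijective_of_injective_endomorphism f hinj
  · exact Or.inr ⟨n + 1, LinearMap.range_eq_bot.1 h⟩

theorem IsIndecModule.exists_bijective_of_sum [IsArtinianRing R] [Module.Finite R X]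
    (hX : IsIndecModule R X) {ι : Type} (s : Finset ι) (a : ι → Module.End R X)
    (h : IsUnit (∑ i ∈ s, a i)) : ∃ i ∈ s, IsUnit (a i) := by
  classical
  induction s using Finset.induction_on with
  | empty =>
    have := hX.1
    simp at h
  | insert i s hi ih =>
    rw [Finset.sum_insert hi] at h
    obtain ⟨u, hu⟩ := h
    rcases hX.bijective_or_isNilpotent (↑u⁻¹ * a i) with h1 | h1
    · refine ⟨i, by simp, ?_⟩
      have := (Module.End.isUnit_iff _).2 h1
      simpa using this
    · have h2 : IsUnit (1 - ↑u⁻¹ * a i) := h1.isUnit_one_sub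
      have h3 : (1 : Module.End R X) - ↑u⁻¹ * a i = ↑u⁻¹ * ∑ i ∈ s, a i := by
        rw [← Units.inv_mul u, hu, mul_add, add_sub_cancel_left]
      rw [h3] at h2
      obtain ⟨j, hj, hj'⟩ := ih (by simpa using h2)
      exact ⟨j, by simp [hj], hj'⟩

/-- An indecomposable direct summand of a finite direct sum is a summand of one of the terms. -/
theorem IsIndecModule.exists_isRetract [IsArtinianRing R] [Module.Finite R X]
    (hX : IsIndecModule R X) {ι : Type} [Finite ι] {Y : ι → Type} [∀ i, AddCommGroup (Y i)]
    [∀ i, Module R (Y i)] (h : IsRetract R X (∀ i, Y i)) : ∃ i, IsRetract R X (Y i) := by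
  classical
  cases nonempty_fintype ι
  obtain ⟨i, r, h⟩ := h
  have hsum : ∑ j, (r ∘ₗ LinearMap.single R Y j ∘ₗ LinearMap.proj j ∘ₗ i : Module.End R X) = 1 := by
    ext x
    rw [LinearMap.sum_apply]
    simp only [LinearMap.comp_apply, LinearMap.proj_apply]
    rw [← map_sum]
    refine Eq.trans ?_ (LinearMap.congr_fun h x)
    rw [LinearMap.comp_apply]
    congr 1
    exact LinearMap.sum_single_apply Y (i x)
  obtain ⟨j, -, hj⟩ := hX.exists_bijective_of_sum Finset.univ _ (hsum ▸ isUnit_one)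
  exact ⟨j, IsRetract.of_bijective (LinearMap.proj j ∘ₗ i) (r ∘ₗ LinearMap.single R Y j)
    ((Module.End.isUnit_iff _).1 hj)⟩

variable (R X) in
/-- A module of finite length is a finite direct sum of indecomposables. -/
theorem exists_equiv_pi_indec [IsArtinian R X] :
    ∃ (ι : Type) (_ : Fintype ι) (Y : ι → Submodule R X),
      (∀ i, IsIndecModule R (Y i)) ∧ Nonempty (X ≃ₗ[R] ∀ i, Y i) := by
  suffices h : ∀ L : Submodule R X, ∃ (ι : Type) (_ : Fintype ι) (Y : ι → Submodule R X),
      (∀ i, IsIndecModule R (Y i)) ∧ Nonempty (L ≃ₗ[R] ∀ i, Y i) by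
    obtain ⟨ι, hι, Y, hY, ⟨e⟩⟩ := h ⊤
    exact ⟨ι, hι, Y, hY, ⟨Submodule.topEquiv.symm ≪≫ₗ e⟩⟩
  intro L
  induction L using (wellFounded_lt (α := Submodule R X)).induction with | h L ih
  by_cases h0 : L = ⊥
  · subst h0
    exact ⟨Empty, inferInstance, fun _ => ⊥, fun i => i.elim, ⟨LinearEquiv.ofSubsingleton _ _⟩⟩
  by_cases hL : IsIndecModule R L
  · exact ⟨Unit, inferInstance, fun _ => L, fun _ => hL,
      ⟨(LinearEquiv.funUnique Unit R L).symm⟩⟩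
  have hnt : Nontrivial L := (Submodule.nontrivial_iff_ne_bot).2 h0
  obtain ⟨N₁, N₂, hc, h1, h2⟩ : ∃ N₁ N₂ : Submodule R L, IsCompl N₁ N₂ ∧ N₁ ≠ ⊥ ∧ N₂ ≠ ⊥ := by
    by_contra! h
    exact hL ⟨hnt, fun N₁ N₂ hc => or_iff_not_imp_left.2 (h N₁ N₂ hc)⟩
  have key : ∀ {N₁ N₂ : Submodule R L}, IsCompl N₁ N₂ → N₂ ≠ ⊥ → N₁.map L.subtype < L := by
    intro N₁ N₂ hc h2
    refine lt_of_le_of_ne (Submodule.map_subtype_le _ _) fun h => h2 ?_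
    have : N₁ = ⊤ := by
      refine Submodule.map_injective_of_injective L.injective_subtype ?_
      rw [h, Submodule.map_subtype_top]
    have := hc.inf_eq_bot
    simp_all
  obtain ⟨ι, _, Y, hY, ⟨e⟩⟩ := ih _ (key hc h2)
  obtain ⟨ι', _, Y', hY', ⟨e'⟩⟩ := ih _ (key hc.symm h1)
  refine ⟨ι ⊕ ι', inferInstance, Sum.elim Y Y', by rintro (i | i); exacts [hY i, hY' i], ⟨?_⟩⟩
  exact (Submodule.prodEquivOfIsCompl N₁ N₂ hc).symm ≪≫ₗ
    (LinearEquiv.prodCongr (Submodule.equivMapOfInjective _ L.injective_subtype N₁ ≪≫ₗ e)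
      (Submodule.equivMapOfInjective _ L.injective_subtype N₂ ≪≫ₗ e')) ≪≫ₗ
    (LinearEquiv.sumPiEquivProdPi R ι ι' fun i => ↥(Sum.elim Y Y' i)).symm

/-- Isomorphism representatives in a finite family of modules. -/
theorem exists_representatives {ι : Type} [Finite ι] (Y : ι → Type) [∀ i, AddCommGroup (Y i)]
    [∀ i, Module R (Y i)] :
    ∃ (n : ℕ) (c : Fin n → ι), (∀ a b, Nonempty (Y (c a) ≃ₗ[R] Y (c b)) → a = b) ∧
      ∀ i, ∃ a, Nonempty (Y i ≃ₗ[R] Y (c a)) := by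
  let s : Setoid ι :=
    { r := fun i j => Nonempty (Y i ≃ₗ[R] Y j)
      iseqv := ⟨fun i => ⟨LinearEquiv.refl R _⟩, fun ⟨e⟩ => ⟨e.symm⟩,
        fun ⟨e⟩ ⟨e'⟩ => ⟨e ≪≫ₗ e'⟩⟩ }
  obtain ⟨n, ⟨e⟩⟩ := Finite.exists_equiv_fin (Quotient s)
  refine ⟨n, fun a => (e.symm a).out, fun a b h => ?_, fun i => ⟨e ⟦i⟧, ?_⟩⟩
  · exact e.symm.injective (Quotient.out_equiv_out.1 h)
  · have h : s (e.symm (e ⟦i⟧)).out i := by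
      rw [e.symm_apply_apply]
      exact Quotient.mk_out i
    exact Setoid.symm' s h

end

end TwoPoint

namespace TwoPoint

open Function

section

variable {R : Type} [Ring R]

theorem isInternal_range_single {ι : Type} [DecidableEq ι] [Fintype ι] (Y : ι → Type)
    [∀ i, AddCommGroup (Y i)] [∀ i, Module R (Y i)] :
    DirectSum.IsInternal fun i => LinearMap.range (LinearMap.single R Y i) := by
  rw [DirectSum.isInternal_submodule_iff_iSupIndep_and_iSup_eq_top]
  refine ⟨fun i => ?_, LinearMap.iSup_range_single R Y⟩
  have h : ⨆ (j) (_ : j ≠ i), LinearMap.range (LinearMap.single R Y j) ≤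
      LinearMap.ker (LinearMap.proj i : (∀ i, Y i) →ₗ[R] Y i) := by
    refine iSup₂_le fun j hj => ?_
    rintro _ ⟨y, rfl⟩
    exact Pi.single_eq_of_ne hj.symm y
  refine Disjoint.mono_right h ?_
  rw [disjoint_iff, eq_bot_iff]
  rintro _ ⟨⟨y, rfl⟩, hy⟩
  have : y = 0 := by simpa using hy
  simp [this]

theorem nonempty_equiv_pi_of_isInternal {k : ℕ} {M : Type} [AddCommGroup M] [Module R M]
    {N : Fin k → Submodule R M} (h : DirectSum.IsInternal N) : Nonempty (M ≃ₗ[R] ∀ i, N i) :=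
  ⟨(LinearEquiv.ofBijective (DirectSum.coeLinearMap N) h).symm ≪≫ₗ
    DirectSum.linearEquivFunOnFintype R _ _⟩

section

variable {n : ℕ} {Y : Fin n → Type} [∀ i, AddCommGroup (Y i)] [∀ i, Module R (Y i)]

theorem hasIndecClassCount_pi (hY : ∀ i, IsIndecModule R (Y i))
    (hiso : ∀ i j, Nonempty (Y i ≃ₗ[R] Y j) → i = j) :
    HasIndecClassCount R (ModuleCat.of R (∀ i, Y i)) n := by
  have e : ∀ i, Y i ≃ₗ[R] LinearMap.range (LinearMap.single R Y i) := fun i =>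
    LinearEquiv.ofInjective _ (Pi.single_injective i)
  refine ⟨n, fun i => LinearMap.range (LinearMap.single R Y i), isInternal_range_single Y,
    fun i => (hY i).of_equiv (e i), id, surjective_id, fun i j => ⟨?_, ?_⟩⟩
  · rintro rfl
    exact ⟨LinearEquiv.refl R _⟩
  · rintro ⟨e'⟩
    exact hiso i j ⟨e i ≪≫ₗ e' ≪≫ₗ (e j).symm⟩

theorem isBasicModuleCat_pi (hY : ∀ i, IsIndecModule R (Y i))
    (hiso : ∀ i j, Nonempty (Y i ≃ₗ[R] Y j) → i = j) :
    IsBasicModuleCat R (ModuleCat.of R (∀ i, Y i)) := by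
  have e : ∀ i, Y i ≃ₗ[R] LinearMap.range (LinearMap.single R Y i) := fun i =>
    LinearEquiv.ofInjective _ (Pi.single_injective i)
  refine ⟨n, fun i => LinearMap.range (LinearMap.single R Y i), isInternal_range_single Y,
    fun i => (hY i).of_equiv (e i), fun i j hij => ⟨fun e' => hij ?_⟩⟩
  exact hiso i j ⟨e i ≪≫ₗ e' ≪≫ₗ (e j).symm⟩

end

variable {A B : Type} [AddCommGroup A] [Module R A] [AddCommGroup B] [Module R B]

theorem Fac.self (A : Type) [AddCommGroup A] [Module R A] : Fac (R := R) A A :=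
  ⟨1, LinearMap.proj 0, fun x => ⟨fun _ => x, rfl⟩⟩

variable (K : Type) [Field K] [Algebra K R] [FiniteDimensional K R]
variable {T : ModPred R}

include K in
theorem Fac.trans {C : Type} [AddCommGroup C] [Module R C] [Module.Finite R A]
    (hAB : Fac (R := R) A B) (hBC : Fac (R := R) B C) : Fac (R := R) A C := by
  have : Module.Finite R C := by
    obtain ⟨k, f, hf⟩ := hAB
    obtain ⟨k', f', hf'⟩ := hBC
    have : Module.Finite R B := Module.Finite.of_surjective f hf
    exact Module.Finite.of_surjective f' hf'
  refine fac_of_iSup_eq_top K (hBC.le_of_forall _ fun g => ?_)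
  have := hAB.le_of_forall ((⨆ g : A →ₗ[R] C, LinearMap.range g).comap g) fun f => by
    rintro _ ⟨x, rfl⟩
    exact _root_.le_iSup (fun g : A →ₗ[R] C => LinearMap.range g) (g ∘ₗ f) ⟨x, rfl⟩
  rintro _ ⟨x, rfl⟩
  exact (this.symm ▸ trivial : x ∈ (⨆ g : A →ₗ[R] C, LinearMap.range g).comap g)

include K in
theorem isTorsionClass_fac [Module.Finite R A] (hA : LiftsAlong (R := R) (Fac A) A) :
    IsTorsionClass (R := R) (Fac A) where
  finite M _ _ := fun ⟨k, f, hf⟩ => Module.Finite.of_surjective f hf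
  of_subsingleton M _ _ _ := ⟨0, 0, fun x => ⟨0, Subsingleton.elim _ _⟩⟩
  of_surjective f hf := fun ⟨k, g, hg⟩ => ⟨k, f ∘ₗ g, hf.comp hg⟩
  of_extension {E N} _ _ _ _ f hf hk hN := by
    have : Module.Finite R N := by
      obtain ⟨k, g, hg⟩ := hN
      exact Module.Finite.of_surjective g hg
    have : Module.Finite R (LinearMap.ker f) := by
      obtain ⟨k, g, hg⟩ := hk
      exact Module.Finite.of_surjective g hg
    have : IsArtinianRing R := IsArtinianRing.of_finite K R
    have : Module.Finite R E := by
      have h1 : (⊤ : Submodule R E).FG := by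
        refine Submodule.fg_of_fg_map_of_fg_inf_ker f ?_ ?_
        · rw [Submodule.map_top, LinearMap.range_eq_top.2 hf]
          exact Module.Finite.fg_top
        · rw [top_inf_eq]
          exact Module.Finite.iff_fg.1 inferInstance
      exact ⟨h1⟩
    refine fac_of_iSup_eq_top K ?_
    set W := ⨆ g : A →ₗ[R] E, LinearMap.range g with hW
    have hker : LinearMap.ker f ≤ W := by
      have := hk.le_of_forall (W.comap (LinearMap.ker f).subtype) fun g => by
        rintro _ ⟨x, rfl⟩
        exact le_iSup (fun g : A →ₗ[R] E => LinearMap.range g) ((LinearMap.ker f).subtype ∘ₗ g)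
          ⟨x, rfl⟩
      intro z hz
      exact (this.symm ▸ trivial : (⟨z, hz⟩ : LinearMap.ker f) ∈
        W.comap (LinearMap.ker f).subtype)
    have hmap : W.map f = ⊤ := hN.le_of_forall _ fun g => by
      obtain ⟨l, rfl⟩ := hA f hf hk g
      rintro _ ⟨x, rfl⟩
      exact ⟨l x, le_iSup (fun g : A →ₗ[R] E => LinearMap.range g) l ⟨x, rfl⟩, rfl⟩
    rw [eq_top_iff]
    rintro x -
    obtain ⟨y, hy, hyx⟩ : f x ∈ W.map f := hmap ▸ trivial
    have : x - y ∈ W := hker (by simp [hyx])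
    simpa using add_mem this hy

theorem fac_of_hdim_eq (hT : IsTorsionClass T) (hA : T A) (hB : T B)
    (h : ∀ (N : Type) [AddCommGroup N] [Module R N], T N → hdim K R A N = hdim K R B N) :
    Fac (R := R) A B := by
  have : Module.Finite R A := hT.finite A hA
  have : Module.Finite R B := hT.finite B hB
  have : IsArtinianRing R := IsArtinianRing.of_finite K R
  refine fac_of_iSup_eq_top K ?_
  set W := ⨆ g : A →ₗ[R] B, LinearMap.range g with hW
  have hTW : T W := by
    obtain ⟨t, htW, ht, hmax⟩ := hT.exists_maximal_sub W
    have : W ≤ t := iSup_le fun g => hmax _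
      (le_iSup (fun g : A →ₗ[R] B => LinearMap.range g) g) (hT.range _ hA)
    rwa [← le_antisymm htW this]
  have h1 : hdim K R A B ≤ hdim K R A W := hdim_le_of_forall_exists K W.subtype fun g =>
    ⟨g.codRestrict W fun x => le_iSup (fun g : A →ₗ[R] B => LinearMap.range g) g ⟨x, rfl⟩, rfl⟩
  rw [h B hB, h W hTW] at h1
  obtain ⟨l, hl⟩ := exists_comp_eq_of_hdim_le K W.subtype
    (fun g hg => by ext x; exact LinearMap.congr_fun hg x) h1 LinearMap.id
  rw [eq_top_iff]
  rintro x -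
  have := LinearMap.congr_fun hl x
  rw [LinearMap.id_apply] at this
  rw [← this]
  exact (l x).2

end

end TwoPoint

namespace TwoPoint

open Function

section

variable {R : Type} [Ring R] {T : ModPred R}

theorem IsLeftApprox.isRetract {Q L A : Type} [AddCommGroup Q] [Module R Q] [AddCommGroup L]
    [Module R L] [AddCommGroup A] [Module R A] {j : Q →ₗ[R] L} {j' : Q →ₗ[R] A}
    (hj : IsLeftApprox T j) (hj' : IsLeftApprox T j')
    (hmin : ∀ e : L →ₗ[R] L, e ∘ₗ j = j → Bijective e) : IsRetract R L A := by
  obtain ⟨f, hf⟩ := hj.2 hj'.1 j'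
  obtain ⟨g, hg⟩ := hj'.2 hj.1 j
  exact IsRetract.of_bijective f g (hmin _ (by rw [LinearMap.comp_assoc, hf, hg]))

theorem exists_indec_isRetract (L : Type) [AddCommGroup L] [Module R L] [IsArtinian R L]
    [Nontrivial L] : ∃ Z : Submodule R L, IsIndecModule R Z ∧ IsRetract R Z L := by
  classical
  obtain ⟨ι, _, Y, hY, ⟨e⟩⟩ := exists_equiv_pi_indec R L
  have : Nonempty ι := by
    by_contra h
    rw [not_nonempty_iff] at h
    have : Subsingleton L := e.toEquiv.subsingleton
    exact not_subsingleton L this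
  obtain ⟨i⟩ := this
  exact ⟨Y i, hY i, (IsRetract.of_pi i).trans (IsRetract.of_equiv e.symm)⟩

variable (K : Type) [Field K] [Algebra K R] [FiniteDimensional K R]

/-- Two Ext-projective objects of a torsion class with the same dimensions of homomorphism spaces
have no pair of decompositions without common summands. -/
theorem exists_common_retract (hT : IsTorsionClass T) {A B : Type} [AddCommGroup A] [Module R A]
    [AddCommGroup B] [Module R B] (hA : T A) (hB : T B) (hA' : LiftsAlong T A)
    (h : ∀ (N : Type) [AddCommGroup N] [Module R N], T N → hdim K R A N = hdim K R B N) :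
    (Subsingleton A ∧ Subsingleton B) ∨
      ∃ (Z : Type) (_ : AddCommGroup Z) (_ : Module R Z), IsIndecModule R Z ∧
        IsRetract R Z A ∧ IsRetract R Z B := by
  have : Module.Finite R A := hT.finite A hA
  have : Module.Finite R B := hT.finite B hB
  have : IsArtinianRing R := IsArtinianRing.of_finite K R
  have hAB : Fac (R := R) A B := fac_of_hdim_eq K hT hA hB h
  have hBA : Fac (R := R) B A := fac_of_hdim_eq K hT hB hA fun N _ _ hN => (h N hN).symm
  have hlift : LiftsAlong (R := R) (Fac A) A := fun q hq hk f => hA' q hq (hT.of_fac hA hk) f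
  have hF : IsTorsionClass (R := R) (Fac A) := isTorsionClass_fac K hlift
  obtain ⟨m, G, hG⟩ := exists_left_approx K (Q := R) hF (Fac.self A) fun N _ _ hN => hN
  obtain ⟨m', G', hG'⟩ := exists_left_approx K (Q := R) hF hAB fun N _ _ hN =>
    hBA.trans K hN
  obtain ⟨L, j, hj, hmin⟩ := hG.exists_minimal hF
  rcases subsingleton_or_nontrivial L with hL | hL
  · left
    have hsub : Subsingleton A := by
      refine ⟨fun x y => ?_⟩
      have key : ∀ x : A, x = 0 := fun x => by
        obtain ⟨ψ, hψ⟩ := hj.2 (Fac.self A) (LinearMap.toSpanSingleton R A x)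
        have := LinearMap.congr_fun hψ 1
        rw [LinearMap.comp_apply, Subsingleton.elim (j 1) 0, map_zero] at this
        simpa using this.symm
      rw [key x, key y]
    refine ⟨hsub, ?_⟩
    obtain ⟨k, f, hf⟩ := hAB
    exact hf.subsingleton
  · right
    obtain ⟨Z, hZ, hZL⟩ := exists_indec_isRetract (R := R) L
    have : Module.Finite R L := hF.finite L hj.1
    have : Module.Finite R Z := hZL.finite
    obtain ⟨-, h1⟩ := hZ.exists_isRetract (hZL.trans (hj.isRetract hG hmin))
    obtain ⟨-, h2⟩ := hZ.exists_isRetract (hZL.trans (hj.isRetract hG' hmin))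
    exact ⟨Z, _, _, hZ, h1, h2⟩

section

variable {ι : Type} [Fintype ι] {X : ι → Type} [∀ i, AddCommGroup (X i)] [∀ i, Module R (X i)]

/-- Dimensions of homomorphism spaces from non-isomorphic indecomposable Ext-projective objects are
linearly independent. -/
theorem eq_zero_of_sum_hdim_eq_zero (hT : IsTorsionClass T) (hX : ∀ i, T (X i))
    (hlift : ∀ i, LiftsAlong T (X i)) (hindec : ∀ i, IsIndecModule R (X i))
    (hiso : ∀ i j, Nonempty (X i ≃ₗ[R] X j) → i = j) (c : ι → ℤ)
    (h : ∀ (N : Type) [AddCommGroup N] [Module R N], T N → ∑ i, c i * hdim K R (X i) N = 0) :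
    ∀ i, c i = 0 := by
  have hfin : ∀ i, Module.Finite R (X i) := fun i => hT.finite _ (hX i)
  have : IsArtinianRing R := IsArtinianRing.of_finite K R
  have hdim_sum : ∀ (a : ι → ℕ) (N : Type) [AddCommGroup N] [Module R N] [Module.Finite R N],
      hdim K R (∀ s : (Σ i, Fin (a i)), X s.1) N = ∑ i, a i * hdim K R (X i) N := by
    intro a N _ _ _
    rw [hdim_pi, Fintype.sum_sigma]
    refine Finset.sum_congr rfl fun i _ => ?_
    refine (Finset.sum_const (hdim K R (X i) N)).trans ?_
    rw [Finset.card_univ, Fintype.card_fin, smul_eq_mul]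
  let a : ι → ℕ := fun i => (c i).toNat
  let b : ι → ℕ := fun i => (-c i).toNat
  have hab : ∀ (N : Type) [AddCommGroup N] [Module R N], T N →
      hdim K R (∀ s : (Σ i, Fin (a i)), X s.1) N = hdim K R (∀ s : (Σ i, Fin (b i)), X s.1) N := by
    intro N _ _ hN
    have : Module.Finite R N := hT.finite N hN
    have h1 := h N hN
    rw [hdim_sum, hdim_sum]
    zify
    rw [← sub_eq_zero, ← Finset.sum_sub_distrib, ← h1]
    refine Finset.sum_congr rfl fun i _ => ?_
    rw [← sub_mul]
    congr 1
    simp only [a, b]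
    omega
  rcases exists_common_retract K hT (hT.pi fun s => hX s.1) (hT.pi fun s => hX s.1)
    (LiftsAlong.pi fun s => hlift s.1) hab with ⟨h1, h2⟩ | ⟨Z, _, _, hZ, h1, h2⟩
  · have key : ∀ a : ι → ℕ, Subsingleton (∀ s : (Σ i, Fin (a i)), X s.1) → ∀ i, a i = 0 := by
      intro a ha i
      by_contra hi
      have := (hindec i).1
      have : IsEmpty (Σ i, Fin (a i)) := by
        by_contra hne
        rw [not_isEmpty_iff] at hne
        have : ∀ s : (Σ i, Fin (a i)), Nontrivial (X s.1) := fun s => (hindec s.1).1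
        obtain ⟨s⟩ := hne
        have := Pi.nontrivial_at s (f := fun s : (Σ i, Fin (a i)) => X s.1)
        exact not_subsingleton _ ha
      exact this.elim ⟨i, 0, Nat.pos_of_ne_zero hi⟩
    intro i
    have h3 := key a h1 i
    have h4 := key b h2 i
    simp only [a, b] at h3 h4
    omega
  · exfalso
    have := hZ.1
    have : Module.Finite R Z := h1.finite
    obtain ⟨⟨i, s⟩, h1⟩ := hZ.exists_isRetract h1
    obtain ⟨⟨k, t⟩, h2⟩ := hZ.exists_isRetract h2
    obtain ⟨e⟩ := h1.nonempty_equiv (hindec i)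
    obtain ⟨e'⟩ := h2.nonempty_equiv (hindec k)
    obtain rfl := hiso i k ⟨e.symm ≪≫ₗ e'⟩
    have hs := s.pos
    have ht := t.pos
    simp only [a, b] at hs ht
    omega

end

end

end TwoPoint

namespace TwoPoint

open Function

section

variable {R : Type} [Ring R] {T : ModPred R}

section

variable {A A' Y : Type} [AddCommGroup A] [Module R A] [AddCommGroup A'] [Module R A']
  [AddCommGroup Y] [Module R Y]

theorem exists_lift_surjective {L : Submodule R A} {L' : Submodule R A'} {π : A →ₗ[R] Y}
    {π' : A' →ₗ[R] Y} [Module.Projective R L] (hπ : L.map π = ⊤) (hπ' : L'.map π' = ⊤)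
    (hmin : ∀ L'' ≤ L', L''.map π' = ⊤ → L'' = L') :
    ∃ u : L →ₗ[R] L', Surjective u := by
  have hs : Surjective (π' ∘ₗ L'.subtype) := fun y => by
    obtain ⟨x, hx, rfl⟩ : y ∈ L'.map π' := hπ' ▸ trivial
    exact ⟨⟨x, hx⟩, rfl⟩
  obtain ⟨u, hu⟩ := Module.projective_lifting_property _ (π ∘ₗ L.subtype) hs
  refine ⟨u, fun y => ?_⟩
  have h := hmin ((LinearMap.range u).map L'.subtype) (Submodule.map_subtype_le _ _) (by
    rw [eq_top_iff]
    rintro y -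
    obtain ⟨x, hx, rfl⟩ : y ∈ L.map π := hπ ▸ trivial
    exact ⟨u ⟨x, hx⟩, ⟨_, ⟨_, rfl⟩, rfl⟩, LinearMap.congr_fun hu ⟨x, hx⟩⟩)
  obtain ⟨_, ⟨x, rfl⟩, hxy⟩ : y.1 ∈ (LinearMap.range u).map L'.subtype :=
    h.ge y.2
  exact ⟨x, Subtype.ext hxy⟩

/-- Uniqueness of projective covers. -/
theorem exists_equiv_of_surjective [IsArtinianRing R] [Module.Finite R A] [Module.Projective R A]
    [Module.Finite R A'] [Module.Projective R A'] {π : A →ₗ[R] Y} {π' : A' →ₗ[R] Y}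
    (hπ : Surjective π) (hπ' : Surjective π') :
    ∃ (L Z : Submodule R A) (L' Z' : Submodule R A'), IsCompl L Z ∧ IsCompl L' Z' ∧
      Z ≤ LinearMap.ker π ∧ Z' ≤ LinearMap.ker π' ∧ Nonempty (L ≃ₗ[R] L') := by
  obtain ⟨L, Z, hc, hZ, hmin⟩ := exists_projective_cover π
  obtain ⟨L', Z', hc', hZ', hmin'⟩ := exists_projective_cover π'
  have key : ∀ {A : Type} [AddCommGroup A] [Module R A] {L Z : Submodule R A} {π : A →ₗ[R] Y},
      IsCompl L Z → Surjective π → Z ≤ LinearMap.ker π → L.map π = ⊤ := by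
    intro A _ _ L Z π hc hπ hZ
    rw [← LinearMap.range_eq_top.2 hπ, LinearMap.range_eq_map, ← hc.sup_eq_top, Submodule.map_sup,
      (LinearMap.le_ker_iff_map).1 hZ, sup_bot_eq]
  have := projective_of_isCompl hc
  have := projective_of_isCompl hc'
  obtain ⟨u, hu⟩ := exists_lift_surjective (key hc hπ hZ) (key hc' hπ' hZ') hmin'
  obtain ⟨v, hv⟩ := exists_lift_surjective (key hc' hπ' hZ') (key hc hπ hZ) hmin
  have hinj : Injective (v ∘ₗ u) := (IsNoetherian.bijective_of_surjective_endomorphism (v ∘ₗ u)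
    (hv.comp hu)).1
  exact ⟨L, Z, L', Z', hc, hc', hZ, hZ', ⟨LinearEquiv.ofBijective u ⟨Injective.of_comp (f := v) hinj, hu⟩⟩⟩

/-- There are no nonzero maps from `Z` to modules in `T`. -/
def IsOrthogonal (T : ModPred R) (Z : Type) [AddCommGroup Z] [Module R Z] : Prop :=
  ∀ (N : Type) [AddCommGroup N] [Module R N], T N → ∀ f : Z →ₗ[R] N, f = 0

end

namespace IsPresentation

variable {X P₁ P₀ P₁' P₀' Q : Type} [AddCommGroup P₁] [Module R P₁] [AddCommGroup P₀]
  [Module R P₀] [AddCommGroup P₁'] [Module R P₁'] [AddCommGroup P₀'] [Module R P₀']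
  [AddCommGroup Q] [Module R Q] [AddCommGroup X] [Module R X]
  {f : P₁ →ₗ[R] P₀} {g : P₀ →ₗ[R] X} {f' : P₁' →ₗ[R] P₀'} {g' : P₀' →ₗ[R] X}

theorem isOrthogonal (h : IsPresentation T f g) {L Z : Submodule R (P₁ × Q)}
    (hc : IsCompl L Z) (hZ : ∀ z ∈ Z, f z.1 = 0 ∧ z.2 = 0) : IsOrthogonal T Z := by
  intro N _ _ hN t
  obtain ⟨h', hh'⟩ := h.extends_along N hN
    ((t ∘ₗ Z.projectionOnto L hc.symm) ∘ₗ LinearMap.inl R P₁ Q)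
  ext z
  obtain ⟨h1, h2⟩ := hZ z z.2
  have h3 := LinearMap.congr_fun hh' z.1.1
  rw [LinearMap.comp_apply, h1, map_zero] at h3
  have h4 : LinearMap.inl R P₁ Q z.1.1 = z.1 := Prod.ext rfl h2.symm
  rw [LinearMap.comp_apply, h4] at h3
  simpa using h3.symm

/-- Two presentations of the same module agree up to projective modules orthogonal to `T`. -/
theorem exists_equiv [IsArtinianRing R] (h : IsPresentation T f g)
    (h' : IsPresentation T f' g') :
    ∃ (L Z : Submodule R (P₁ × P₀')) (L' Z' : Submodule R (P₁' × P₀)), IsCompl L Z ∧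
      IsCompl L' Z' ∧ IsOrthogonal T Z ∧ IsOrthogonal T Z' ∧ Nonempty (L ≃ₗ[R] L') := by
  have := h.finite₀
  have := h.finite₁
  have := h.projective₀
  have := h.projective₁
  have := h'.finite₀
  have := h'.finite₁
  have := h'.projective₀
  have := h'.projective₁
  obtain ⟨s, hs⟩ := Module.projective_lifting_property g g' h.surjective
  obtain ⟨s', hs'⟩ := Module.projective_lifting_property g' g h'.surjective
  let Y : Submodule R (P₀ × P₀') := LinearMap.ker (g.coprod (-g'))
  have hY : ∀ y : P₀ × P₀', y ∈ Y ↔ g y.1 = g' y.2 := fun y => by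
    simp only [Y, LinearMap.mem_ker, LinearMap.coprod_apply, LinearMap.neg_apply]
    rw [← sub_eq_add_neg, sub_eq_zero]
  have hf : ∀ x, g (f x) = 0 := fun x => by
    have : f x ∈ LinearMap.ker g := h.range_eq ▸ ⟨x, rfl⟩
    exact this
  have hf' : ∀ x, g' (f' x) = 0 := fun x => by
    have : f' x ∈ LinearMap.ker g' := h'.range_eq ▸ ⟨x, rfl⟩
    exact this
  have hs0 : ∀ x, g (s x) = g' x := LinearMap.congr_fun hs
  have hs0' : ∀ x, g' (s' x) = g x := LinearMap.congr_fun hs'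
  let π : P₁ × P₀' →ₗ[R] Y := ((f.coprod s).prod (LinearMap.snd R P₁ P₀')).codRestrict Y
    fun x => (hY _).2 (by simp [hf, hs0])
  let π' : P₁' × P₀ →ₗ[R] Y := ((LinearMap.snd R P₁' P₀).prod (f'.coprod s')).codRestrict Y
    fun x => (hY _).2 (by simp [hf', hs0'])
  have hπ : Surjective π := by
    rintro ⟨⟨a, b⟩, hab⟩
    have hab' : g a = g' b := (hY _).1 hab
    obtain ⟨x, hx⟩ : a - s b ∈ LinearMap.range f := by
      rw [h.range_eq, LinearMap.mem_ker, map_sub, hs0, hab', sub_self]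
    exact ⟨(x, b), Subtype.ext (Prod.ext (by simp [π, hx]) rfl)⟩
  have hπ' : Surjective π' := by
    rintro ⟨⟨a, b⟩, hab⟩
    have hab' : g a = g' b := (hY _).1 hab
    obtain ⟨x, hx⟩ : b - s' a ∈ LinearMap.range f' := by
      rw [h'.range_eq, LinearMap.mem_ker, map_sub, hs0', hab', sub_self]
    exact ⟨(x, a), Subtype.ext (Prod.ext rfl (by simp [π', hx]))⟩
  obtain ⟨L, Z, L', Z', hc, hc', hZ, hZ', e⟩ := exists_equiv_of_surjective hπ hπ'
  refine ⟨L, Z, L', Z', hc, hc', h.isOrthogonal hc fun z hz => ?_,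
    h'.isOrthogonal hc' fun z hz => ?_, e⟩
  · have h1 : (π z).1 = 0 := by rw [LinearMap.mem_ker.1 (hZ hz)]; rfl
    have h2 : z.2 = 0 := congrArg Prod.snd h1
    have h3 : f z.1 + s z.2 = 0 := congrArg Prod.fst h1
    rw [h2, map_zero, add_zero] at h3
    exact ⟨h3, h2⟩
  · have h1 : (π' z).1 = 0 := by rw [LinearMap.mem_ker.1 (hZ' hz)]; rfl
    have h2 : z.2 = 0 := congrArg Prod.fst h1
    have h3 : f' z.1 + s' z.2 = 0 := congrArg Prod.snd h1
    rw [h2, map_zero, add_zero] at h3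
    exact ⟨h3, h2⟩

theorem trans_equiv {X' : Type} [AddCommGroup X'] [Module R X'] (h : IsPresentation T f g)
    (e : X ≃ₗ[R] X') : IsPresentation T f (e.toLinearMap ∘ₗ g) where
  finite₁ := h.finite₁
  projective₁ := h.projective₁
  finite₀ := h.finite₀
  projective₀ := h.projective₀
  surjective := e.surjective.comp h.surjective
  range_eq := by rw [h.range_eq, LinearEquiv.ker_comp]
  extends_along := h.extends_along

/-- A presentation of the cokernel of a left approximation. -/
theorem coker [Module.Finite R Q] [Module.Projective R Q] (h : IsPresentation T f g)
    {G : Q →ₗ[R] X} (hG : IsLeftApprox T G) {q : Q →ₗ[R] P₀} (hq : g ∘ₗ q = G) :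
    IsPresentation T (f.coprod q) ((LinearMap.range G).mkQ ∘ₗ g) where
  finite₁ := by
    have := h.finite₁
    infer_instance
  projective₁ := by
    have := h.projective₁
    infer_instance
  finite₀ := h.finite₀
  projective₀ := h.projective₀
  surjective := (Submodule.mkQ_surjective _).comp h.surjective
  range_eq := by
    have hgq : ∀ y, g (q y) = G y := LinearMap.congr_fun hq
    ext x
    simp only [LinearMap.mem_range, LinearMap.mem_ker, LinearMap.comp_apply, Submodule.mkQ_apply,
      Submodule.Quotient.mk_eq_zero, LinearMap.coprod_apply, Prod.exists]
    constructor
    · rintro ⟨a, b, rfl⟩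
      have : f a ∈ LinearMap.ker g := h.range_eq ▸ ⟨a, rfl⟩
      exact ⟨b, by rw [map_add, LinearMap.mem_ker.1 this, zero_add, hgq]⟩
    · rintro ⟨b, hb⟩
      obtain ⟨a, ha⟩ : x - q b ∈ LinearMap.range f := by
        rw [h.range_eq, LinearMap.mem_ker, map_sub, hgq, hb, sub_self]
      exact ⟨a, b, by rw [ha, sub_add_cancel]⟩
  extends_along N _ _ hN u := by
    obtain ⟨v, hv⟩ := h.extends_along N hN (u ∘ₗ LinearMap.inl R P₁ Q)
    obtain ⟨ψ, hψ⟩ := hG.2 hN (u ∘ₗ LinearMap.inr R P₁ Q - v ∘ₗ q)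
    refine ⟨v + ψ ∘ₗ g, LinearMap.prod_ext ?_ ?_⟩
    · ext x
      have h1 : f x ∈ LinearMap.ker g := h.range_eq ▸ ⟨x, rfl⟩
      have h2 := LinearMap.congr_fun hv x
      simp only [LinearMap.comp_apply] at h2
      simp [h2, LinearMap.mem_ker.1 h1]
    · ext x
      have h1 : g (q x) = G x := LinearMap.congr_fun hq x
      have h2 := LinearMap.congr_fun hψ x
      simp only [LinearMap.comp_apply, LinearMap.sub_apply] at h2
      simp [h1, h2]

theorem pi {ι : Type} [Fintype ι] {X P₁ P₀ : ι → Type} [∀ i, AddCommGroup (X i)]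
    [∀ i, Module R (X i)] [∀ i, AddCommGroup (P₁ i)] [∀ i, Module R (P₁ i)]
    [∀ i, AddCommGroup (P₀ i)] [∀ i, Module R (P₀ i)] {f : ∀ i, P₁ i →ₗ[R] P₀ i}
    {g : ∀ i, P₀ i →ₗ[R] X i} (h : ∀ i, IsPresentation T (f i) (g i)) :
    IsPresentation T (LinearMap.pi fun i => f i ∘ₗ LinearMap.proj i)
      (LinearMap.pi fun i => g i ∘ₗ LinearMap.proj i) where
  finite₁ := by
    have := fun i => (h i).finite₁
    infer_instance
  projective₁ := by
    have := fun i => (h i).projective₁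
    classical
    exact Module.Projective.of_equiv (DirectSum.linearEquivFunOnFintype R ι P₁)
  finite₀ := by
    have := fun i => (h i).finite₀
    infer_instance
  projective₀ := by
    have := fun i => (h i).projective₀
    classical
    exact Module.Projective.of_equiv (DirectSum.linearEquivFunOnFintype R ι P₀)
  surjective x := by
    choose y hy using fun i => (h i).surjective (x i)
    exact ⟨y, funext hy⟩
  range_eq := by
    ext x
    have h1 : ∀ i, x i ∈ LinearMap.range (f i) ↔ g i (x i) = 0 := fun i => by
      rw [(h i).range_eq, LinearMap.mem_ker]
    constructor
    · rintro ⟨y, rfl⟩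
      refine LinearMap.mem_ker.2 (funext fun i => (h1 i).1 ⟨y i, rfl⟩)
    · intro hx
      choose y hy using fun i => (h1 i).2 (congrFun (LinearMap.mem_ker.1 hx) i)
      exact ⟨y, funext hy⟩
  extends_along N _ _ hN u := by
    classical
    choose v hv using fun i => (h i).extends_along N hN (u ∘ₗ LinearMap.single R P₁ i)
    refine ⟨LinearMap.lsum R P₀ ℕ v, LinearMap.pi_ext' fun i => ?_⟩
    rw [← hv i]
    ext x
    simp only [LinearMap.comp_apply]
    refine Eq.trans ?_ (LinearMap.lsum_piSingle (S := ℕ) (f := v) (i := i) (x := f i x))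
    congr 1
    funext j
    by_cases hj : j = i
    · subst hj
      simp
    · simp [hj]

end IsPresentation

end

end TwoPoint

namespace TwoPoint

open Function

section

variable {R : Type} [Ring R] {T : ModPred R}

theorem LiftsAlong.of_projective {P : Type} [AddCommGroup P] [Module R P] [Module.Projective R P] :
    LiftsAlong T P :=
  fun q hq _ f => Module.projective_lifting_property q f hq

theorem fac_regular (N : Type) [AddCommGroup N] [Module R N] [Module.Finite R N] :
    Fac (R := R) R N :=
  Module.Finite.exists_fin' R N

theorem exists_equiv_pi_of_retract [IsArtinianRing R] {Q : Type} [AddCommGroup Q] [Module R Q]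
    [Module.Finite R Q] {ι : Type} {X : ι → Type} [∀ i, AddCommGroup (X i)]
    [∀ i, Module R (X i)]
    (h : ∀ Z : Submodule R Q, IsIndecModule R Z → IsRetract R Z Q →
      ∃ i, Nonempty (Z ≃ₗ[R] X i)) :
    ∃ (κ : Type) (_ : Fintype κ) (c : κ → ι), Nonempty (Q ≃ₗ[R] ∀ k, X (c k)) := by
  classical
  obtain ⟨κ, hκ, Y, hY, ⟨e⟩⟩ := exists_equiv_pi_indec R Q
  choose c hc using fun k => h (Y k) (hY k)
    ((IsRetract.of_pi (Y := fun k => Y k) k).trans (IsRetract.of_equiv e.symm))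
  exact ⟨κ, hκ, c, ⟨e ≪≫ₗ LinearEquiv.piCongrRight fun k => (hc k).some⟩⟩

variable (K : Type) [Field K] [Algebra K R]

/-- The dimensions of the spaces of homomorphisms from `P` to finitely generated modules. -/
def hvec (K : Type) [Field K] (R : Type) [Ring R] [Algebra K R] (P : Type) [AddCommGroup P] [Module R P] :
    {N : ModuleCat.{0} R // Module.Finite R N} → ℤ :=
  fun N => hdim K R P N.1

section

variable {A B : Type} [AddCommGroup A] [Module R A] [AddCommGroup B] [Module R B]

theorem hvec_congr (e : A ≃ₗ[R] B) : hvec K R A = hvec K R B :=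
  funext fun _ => congrArg Nat.cast (hdim_congr_left K e)

variable [FiniteDimensional K R]

theorem hvec_prod [Module.Finite R A] [Module.Finite R B] :
    hvec K R (A × B) = hvec K R A + hvec K R B := by
  funext N
  have := N.2
  simp [hvec, hdim_prod]

theorem hvec_pi {ι : Type} [Fintype ι] {X : ι → Type} [∀ i, AddCommGroup (X i)]
    [∀ i, Module R (X i)] [∀ i, Module.Finite R (X i)] :
    hvec K R (∀ i, X i) = ∑ i, hvec K R (X i) := by
  funext N
  have := N.2
  simp [hvec, hdim_pi]

theorem hvec_of_isCompl [Module.Finite R A] {L Z : Submodule R A} (h : IsCompl L Z) :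
    hvec K R A = hvec K R L + hvec K R Z := by
  have := (IsRetract.of_isCompl h).finite
  have := (IsRetract.of_isCompl h.symm).finite
  rw [← hvec_prod, hvec_congr K (Submodule.prodEquivOfIsCompl L Z h)]

end

variable [FiniteDimensional K R]

/-- Dimension vectors of non-isomorphic indecomposable projectives are linearly independent. -/
theorem linearIndependent_hvec {ι : Type} [Fintype ι] {X : ι → Type} [∀ i, AddCommGroup (X i)]
    [∀ i, Module R (X i)] [∀ i, Module.Finite R (X i)] [∀ i, Module.Projective R (X i)]
    (hindec : ∀ i, IsIndecModule R (X i)) (hiso : ∀ i j, Nonempty (X i ≃ₗ[R] X j) → i = j) :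
    LinearIndependent ℤ fun i => hvec K R (X i) := by
  rw [Fintype.linearIndependent_iff]
  intro c hc
  have hF : IsTorsionClass (R := R) (Fac R) := isTorsionClass_fac K LiftsAlong.of_projective
  refine eq_zero_of_sum_hdim_eq_zero K hF (fun i => fac_regular (X i))
    (fun i => LiftsAlong.of_projective) hindec hiso c fun N _ _ hN => ?_
  have := congrFun hc ⟨ModuleCat.of R N, hF.finite N hN⟩
  simpa [hvec] using this

section

variable {p q r : ℕ} {N : Fin r → Type} [∀ i, AddCommGroup (N i)] [∀ i, Module R (N i)]
variable {X : Fin p → Type} [∀ i, AddCommGroup (X i)] [∀ i, Module R (X i)]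

theorem exists_projective_equiv_pi (e : R ≃ₗ[R] ∀ i, N i) (hN : ∀ i, IsIndecModule R (N i))
    {Q : Type} [AddCommGroup Q] [Module R Q] [Module.Finite R Q] [Module.Projective R Q]
    [IsArtinianRing R] :
    ∃ (κ : Type) (_ : Fintype κ) (c : κ → Fin r), Nonempty (Q ≃ₗ[R] ∀ k, N (c k)) := by
  refine exists_equiv_pi_of_retract fun Z hZ hZQ => ?_
  have := hZQ.finite
  have := hZ.1
  obtain ⟨n, f, hf⟩ := Module.Finite.exists_fin' R Q
  obtain ⟨s, hs⟩ := Module.projective_lifting_property f LinearMap.id hf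
  obtain ⟨-, h⟩ := hZ.exists_isRetract (hZQ.trans ⟨s, f, hs⟩)
  obtain ⟨i, h⟩ := hZ.exists_isRetract (h.trans (IsRetract.of_equiv e))
  exact ⟨i, h.nonempty_equiv (hN i)⟩

include K in
/-- The number of indecomposable Ext-projectives together with the number of indecomposable
projectives orthogonal to the torsion class is the rank of the algebra. -/
theorem add_eq_of_representatives (hT : IsTorsionClass T) {U : Type} [AddCommGroup U] [Module R U]
    (hU : IsExtGenerator T U)
    (e : R ≃ₗ[R] ∀ i, N i) (hN : ∀ i, IsIndecModule R (N i))
    (hNiso : ∀ i j, Nonempty (N i ≃ₗ[R] N j) → i = j)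
    (hXT : ∀ i, T (X i)) (hlift : ∀ i, LiftsAlong T (X i)) (hX : ∀ i, IsIndecModule R (X i))
    (hXiso : ∀ i j, Nonempty (X i ≃ₗ[R] X j) → i = j)
    (hXall : ∀ (Z : Type) [AddCommGroup Z] [Module R Z], T Z → LiftsAlong T Z →
      IsIndecModule R Z → ∃ i, Nonempty (Z ≃ₗ[R] X i))
    (d : Fin q → Fin r) (hd : Injective d)
    (hdN : ∀ i, (∃ j, d j = i) ↔ IsOrthogonal T (N i)) : p + q = r := by
  classical
  have : IsArtinianRing R := IsArtinianRing.of_finite K R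
  have hNret : ∀ i, IsRetract R (N i) R := fun i =>
    (IsRetract.of_pi i).trans (IsRetract.of_equiv e.symm)
  have hNfin : ∀ i, Module.Finite R (N i) := fun i => (hNret i).finite
  have hNproj : ∀ i, Module.Projective R (N i) := fun i => (hNret i).projective
  have hXfin : ∀ i, Module.Finite R (X i) := fun i => hT.finite _ (hXT i)
  choose P₁ P₀ _ _ _ _ f g hfg using fun i => LiftsAlong.exists_presentation hT (hlift i)
  let v : Fin p ⊕ Fin q → {N : ModuleCat.{0} R // Module.Finite R N} → ℤ :=
    Sum.elim (fun i => hvec K R (P₀ i) - hvec K R (P₁ i)) fun j => hvec K R (N (d j))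
  have hPmem : ∀ (Q : Type) [AddCommGroup Q] [Module R Q] [Module.Finite R Q]
      [Module.Projective R Q], hvec K R Q ∈ Submodule.span ℤ (Set.range fun i => hvec K R (N i)) := by
    intro Q _ _ _ _
    obtain ⟨κ, _, c, ⟨e'⟩⟩ := exists_projective_equiv_pi e hN (Q := Q)
    rw [hvec_congr K e', hvec_pi]
    exact Submodule.sum_mem _ fun k _ => Submodule.subset_span ⟨c k, rfl⟩
  have hZmem : ∀ (Z : Type) [AddCommGroup Z] [Module R Z] [Module.Finite R Z]
      [Module.Projective R Z], IsOrthogonal T Z → hvec K R Z ∈ Submodule.span ℤ (Set.range v) := by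
    intro Z _ _ _ _ hZ
    obtain ⟨κ, _, c, ⟨e'⟩⟩ := exists_projective_equiv_pi e hN (Q := Z)
    rw [hvec_congr K e', hvec_pi]
    refine Submodule.sum_mem _ fun k _ => Submodule.subset_span ?_
    obtain ⟨j, hj⟩ := (hdN (c k)).2 fun M _ _ hM t => by
      have h1 := hZ M hM (t ∘ₗ LinearMap.proj k ∘ₗ e'.toLinearMap)
      ext x
      have h2 := LinearMap.congr_fun h1 (e'.symm (Pi.single k x))
      simpa using h2
    exact ⟨Sum.inr j, by rw [← hj]; rfl⟩
  have hgmem : ∀ (Y Q₁ Q₀ : Type) [AddCommGroup Y] [Module R Y] [AddCommGroup Q₁] [Module R Q₁]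
      [AddCommGroup Q₀] [Module R Q₀] (f' : Q₁ →ₗ[R] Q₀) (g' : Q₀ →ₗ[R] Y), T Y → LiftsAlong T Y →
      IsPresentation T f' g' → hvec K R Q₀ - hvec K R Q₁ ∈ Submodule.span ℤ (Set.range v) := by
    intro Y Q₁ Q₀ _ _ _ _ _ _ f' g' hY hYl h'
    have : Module.Finite R Y := hT.finite Y hY
    obtain ⟨κ, _, c, ⟨e'⟩⟩ := exists_equiv_pi_of_retract (R := R) (Q := Y) (X := X)
      fun Z hZ hZY => by
        obtain ⟨i, s, his⟩ := hZY
        exact hXall Z (hT.of_surjective s (fun x => ⟨i x, LinearMap.congr_fun his x⟩) hY)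
          (LiftsAlong.of_retract hYl i s his) hZ
    have hpres := (IsPresentation.pi fun k => hfg (c k)).trans_equiv e'.symm
    obtain ⟨L, Z, L', Z', hc, hc', hZ, hZ', ⟨eL⟩⟩ := hpres.exists_equiv h'
    have := h'.finite₀
    have := h'.finite₁
    have := h'.projective₀
    have := h'.projective₁
    have := fun k => (hfg k).finite₀
    have := fun k => (hfg k).finite₁
    have := fun k => (hfg k).projective₀
    have := fun k => (hfg k).projective₁
    have := hpres.projective₀
    have := hpres.projective₁
    have h1 := hvec_of_isCompl K hc
    have h2 := hvec_of_isCompl K hc'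
    rw [hvec_prod, hvec_pi] at h1 h2
    rw [hvec_congr K eL] at h1
    have := (IsRetract.of_isCompl hc.symm).finite
    have := (IsRetract.of_isCompl hc'.symm).finite
    have := (IsRetract.of_isCompl hc.symm).projective
    have := (IsRetract.of_isCompl hc'.symm).projective
    have h3 : hvec K R Q₀ - hvec K R Q₁ = (∑ k, (hvec K R (P₀ (c k)) - hvec K R (P₁ (c k)))) +
        hvec K R Z - hvec K R Z' := by
      rw [Finset.sum_sub_distrib, eq_sub_of_add_eq' h1, eq_sub_of_add_eq h2]
      abel
    rw [h3]
    refine sub_mem (add_mem (Submodule.sum_mem _ fun k _ => Submodule.subset_span ?_)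
      (hZmem Z hZ)) (hZmem Z' hZ')
    exact ⟨Sum.inl (c k), rfl⟩
  have hspan : Submodule.span ℤ (Set.range v) =
      Submodule.span ℤ (Set.range fun i => hvec K R (N i)) := by
    refine le_antisymm (Submodule.span_le.2 ?_) (Submodule.span_le.2 ?_)
    · rintro _ ⟨i | j, rfl⟩
      · have := (hfg i).finite₀
        have := (hfg i).finite₁
        have := (hfg i).projective₀
        have := (hfg i).projective₁
        exact sub_mem (hPmem _) (hPmem _)
      · exact Submodule.subset_span ⟨d j, rfl⟩
    · rintro _ ⟨i, rfl⟩
      have : Module.Finite R U := hU.finite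
      obtain ⟨m, G, hG⟩ := exists_left_approx K (Q := N i) hT hU.mem hU.fac
      have hl : LiftsAlong T (Fin m → U) := LiftsAlong.pi fun _ => hU.lifts
      obtain ⟨Q₁, Q₀, _, _, _, _, f', g', h'⟩ := LiftsAlong.exists_presentation hT hl
      have := h'.finite₁
      have := h'.projective₀
      obtain ⟨q', hq'⟩ := Module.projective_lifting_property g' G h'.surjective
      have h1 := hgmem _ _ _ f' g' hG.1 hl h'
      have h2 := hgmem _ _ _ _ _ (hT.of_surjective _ (Submodule.mkQ_surjective _) hG.1)
        (hG.liftsAlong_coker hl) (h'.coker hG hq')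
      have h3 := sub_mem h1 h2
      rw [hvec_prod] at h3
      simpa using h3
  have hvli : LinearIndependent ℤ v := by
    rw [Fintype.linearIndependent_iff]
    intro c hc
    rw [Fintype.sum_sum_type] at hc
    have h1 : ∀ i, c (Sum.inl i) = 0 := by
      refine eq_zero_of_sum_hdim_eq_zero K hT hXT hlift hX hXiso _ fun M _ _ hM => ?_
      have : Module.Finite R M := hT.finite M hM
      have h2 := congrFun hc ⟨ModuleCat.of R M, this⟩
      have h3 : ∀ j, hdim K R (N (d j)) M = 0 := fun j =>
        (hdim_eq_zero_iff K).2 ((hdN _).1 ⟨j, rfl⟩ M hM)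
      have h4 : ∀ i, (hdim K R (P₀ i) M : ℤ) - hdim K R (P₁ i) M = hdim K R (X i) M := fun i => by
        have := (hfg i).finite₀
        have := hdim_presentation K (hfg i).surjective (hfg i).range_eq ((hfg i).extends_along M hM)
        omega
      simp only [Pi.add_apply, Finset.sum_apply, Pi.smul_apply, v, Sum.elim_inl, Sum.elim_inr,
        Pi.sub_apply, hvec, h3, smul_eq_mul, h4, Nat.cast_zero, mul_zero, Finset.sum_const_zero,
        add_zero, Pi.zero_apply] at h2
      exact h2
    have h2 : ∀ j, c (Sum.inr j) = 0 := by
      refine Fintype.linearIndependent_iff.1 (linearIndependent_hvec K (X := fun j => N (d j))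
        (fun j => hN _) fun i j h => hd (hNiso _ _ h)) _ ?_
      simpa [h1, v] using hc
    rintro (i | j)
    exacts [h1 i, h2 j]
  have h1 := finrank_span_eq_card hvli
  have h2 := finrank_span_eq_card (linearIndependent_hvec K hN hNiso)
  rw [hspan, h2] at h1
  simpa using h1.symm

end

end

end TwoPoint

namespace TwoPoint

open Function

section

variable {R : Type} [Ring R] {T : ModPred R}
variable (K : Type) [Field K] [Algebra K R] [FiniteDimensional K R]

include K in
theorem IsExtGenerator.exists_indec (hT : IsTorsionClass T) {U : Type} [AddCommGroup U]
    [Module R U] (hU : IsExtGenerator T U) :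
    ∃ (p : ℕ) (X : Fin p → Submodule R U), (∀ i, T (X i)) ∧ (∀ i, LiftsAlong T (X i)) ∧
      (∀ i, IsIndecModule R (X i)) ∧ (∀ i j, Nonempty (X i ≃ₗ[R] X j) → i = j) ∧
      Fac (R := R) (∀ i, X i) U ∧
      ∀ (Z : Type) [AddCommGroup Z] [Module R Z], T Z → LiftsAlong T Z →
        IsIndecModule R Z → ∃ i, Nonempty (Z ≃ₗ[R] X i) := by
  classical
  have : IsArtinianRing R := IsArtinianRing.of_finite K R
  have : Module.Finite R U := hU.finite
  obtain ⟨ι, _, Y, hY, ⟨e⟩⟩ := exists_equiv_pi_indec R U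
  obtain ⟨p, c, hc, hc'⟩ := exists_representatives (R := R) fun i => Y i
  have hret : ∀ i, IsRetract R (Y i) U := fun i =>
    (IsRetract.of_pi (Y := fun i => Y i) i).trans (IsRetract.of_equiv e.symm)
  have hYT : ∀ i, T (Y i) := fun i => by
    obtain ⟨s, t, h⟩ := hret i
    exact hT.of_surjective t (fun x => ⟨s x, LinearMap.congr_fun h x⟩) hU.mem
  refine ⟨p, fun a => Y (c a), fun a => hYT _, fun a => ?_, fun a => hY _, hc, ?_, ?_⟩
  · obtain ⟨s, t, h⟩ := hret (c a)
    exact LiftsAlong.of_retract hU.lifts s t h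
  · have hfin : ∀ i, Module.Finite R (Y i) := fun i => (hret i).finite
    refine fac_of_iSup_eq_top K ?_
    rw [eq_top_iff, ← LinearEquiv.range e.symm, LinearMap.range_eq_map,
      ← LinearMap.iSup_range_single R fun i => Y i, Submodule.map_iSup]
    refine iSup_le fun i => ?_
    obtain ⟨a, ⟨f⟩⟩ := hc' i
    refine le_trans ?_ (le_iSup _ (e.symm.toLinearMap ∘ₗ LinearMap.single R (fun i => Y i) i ∘ₗ
      f.symm.toLinearMap ∘ₗ LinearMap.proj a))
    rintro _ ⟨_, ⟨y, rfl⟩, rfl⟩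
    exact ⟨Pi.single a (f y), by simp⟩
  · intro Z _ _ hZT hZl hZ
    have : Module.Finite R Z := hT.finite Z hZT
    have := hZ.1
    obtain ⟨m, s, t, h⟩ := hU.exists_retract K hT hZT hZl
    obtain ⟨-, h⟩ := hZ.exists_isRetract ⟨s, t, h⟩
    obtain ⟨i, h⟩ := hZ.exists_isRetract (h.trans (IsRetract.of_equiv e))
    obtain ⟨f⟩ := h.nonempty_equiv (hY i)
    obtain ⟨a, ⟨g⟩⟩ := hc' i
    exact ⟨a, ⟨f ≪≫ₗ g⟩⟩

include K in
/-- Over a basic algebra, a torsion class with an Ext-projective generator is the class of factor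
modules of a basic support τ-tilting module. -/
theorem IsExtGenerator.exists_isSupportTauTiltingCat
    (hb : IsBasicModuleCat R (ModuleCat.of R R)) (hT : IsTorsionClass T) {U : Type}
    [AddCommGroup U] [Module R U] (hU : IsExtGenerator T U) :
    ∃ M : ModuleCat.{0} R, IsSupportTauTiltingCat R M ∧ IsBasicModuleCat R M ∧
      ∀ (N : Type) [AddCommGroup N] [Module R N], T N ↔ Fac (R := R) M N := by
  classical
  have : IsArtinianRing R := IsArtinianRing.of_finite K R
  obtain ⟨p, X, hXT, hXl, hX, hXiso, hXU, hXall⟩ := hU.exists_indec K hT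
  obtain ⟨r, N, hN, hNi, hNiso⟩ := hb
  have hNiso' : ∀ i j, Nonempty (N i ≃ₗ[R] N j) → i = j := fun i j ⟨f⟩ => by
    by_contra hij
    exact (hNiso i j hij).false f
  obtain ⟨e⟩ := nonempty_equiv_pi_of_isInternal (R := R) (M := R) hN
  have hNret : ∀ i, IsRetract R (N i) R := fun i =>
    (IsRetract.of_pi (Y := fun i => N i) i).trans (IsRetract.of_equiv e.symm)
  have hNfin : ∀ i, Module.Finite R (N i) := fun i => (hNret i).finite
  have hNproj : ∀ i, Module.Projective R (N i) := fun i => (hNret i).projective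
  obtain ⟨q, ⟨φ⟩⟩ := Finite.exists_equiv_fin {i // IsOrthogonal T (N i)}
  let d : Fin q → Fin r := fun j => (φ.symm j).1
  have hd : Injective d := Subtype.val_injective.comp φ.symm.injective
  have hdN : ∀ i, (∃ j, d j = i) ↔ IsOrthogonal T (N i) := fun i =>
    ⟨by rintro ⟨j, rfl⟩; exact (φ.symm j).2, fun h => ⟨φ ⟨i, h⟩, by simp [d]⟩⟩
  have hM : T (∀ i, X i) := hT.pi hXT
  have hMl : LiftsAlong T (∀ i, X i) := LiftsAlong.pi hXl
  have : Module.Finite R (∀ i, X i) := hT.finite _ hM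
  refine ⟨ModuleCat.of R (∀ i, X i), ⟨⟨this, ?_⟩, ModuleCat.of R (∀ j, N (d j)), p, q, r, ?_, ?_, ?_,
    hasIndecClassCount_pi hX hXiso, hasIndecClassCount_pi (fun j => hNi (d j))
      fun i j h => hd (hNiso' _ _ h), ?_, ?_⟩, isBasicModuleCat_pi hX hXiso, fun Z _ _ => ⟨fun h => ?_, ?_⟩⟩
  · obtain ⟨P₁, P₀, _, _, _, _, f, g, h⟩ := LiftsAlong.exists_presentation hT hMl
    refine ⟨ModuleCat.of R P₁, ModuleCat.of R P₀, f, g, h.finite₁, h.projective₁, h.finite₀,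
      h.projective₀, h.surjective, h.range_eq, fun u => ?_⟩
    obtain ⟨v, hv⟩ := h.extends_along _ hM u
    exact ⟨v, hv.symm⟩
  · exact inferInstanceAs (Module.Finite R (∀ j, N (d j)))
  · exact Module.Projective.of_equiv (DirectSum.linearEquivFunOnFintype R _ fun j => N (d j))
  · intro f
    refine LinearMap.pi_ext' (φ := fun j => N (d j)) fun j => ?_
    exact ((hdN _).1 ⟨j, rfl⟩ _ hM _).trans (LinearMap.zero_comp _).symm
  · refine ⟨r, N, hN, hNi, id, surjective_id, fun i j => ⟨?_, hNiso' i j⟩⟩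
    rintro rfl
    exact ⟨LinearEquiv.refl R _⟩
  · exact add_eq_of_representatives K hT hU e hNi hNiso' hXT hXl hX hXiso hXall d hd hdN
  · exact hXU.trans K (hU.fac Z h)
  · exact hT.of_fac hM

end

end TwoPoint

namespace TwoPoint

open Function

/-- Up to equivalence there are only finitely many torsion classes. -/
def HasFiniteTorsionClasses (R : Type) [Ring R] : Prop :=
  ∃ (n : ℕ) (F : Fin n → ModPred R), ∀ T : ModPred R, IsTorsionClass T →
    ∃ i, ∀ (N : Type) [AddCommGroup N] [Module R N], T N ↔ F i N

section

variable {R : Type} [Ring R]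
variable (K : Type) [Field K] [Algebra K R] [FiniteDimensional K R]

include K in
theorem hasFiniteTorsionClasses_of_generators {n : ℕ} (F : Fin n → ModPred R)
    (hF : ∀ (T : ModPred R) (U : Type) [AddCommGroup U] [Module R U], IsTorsionClass T →
      IsExtGenerator T U → ∃ i, ∀ (N : Type) [AddCommGroup N] [Module R N], T N ↔ F i N) :
    HasFiniteTorsionClasses R := by
  refine ⟨n, F, fun T' hT' => ?_⟩
  have : IsArtinianRing R := IsArtinianRing.of_finite K R
  let lt : Fin n → Fin n → Prop := fun i j =>
    (∀ (N : Type) [AddCommGroup N] [Module R N], F i N → F j N) ∧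
      ∃ (N : Type) (_ : AddCommGroup N) (_ : Module R N), F j N ∧ ¬ F i N
  have : IsTrans (Fin n) lt := ⟨by
    rintro i j k ⟨hij, -⟩ ⟨hjk, N, _, _, hN, hN'⟩
    exact ⟨fun N _ _ h => hjk N (hij N h), N, _, _, hN, fun h => hN' (hij N h)⟩⟩
  have : Std.Irrefl lt := ⟨by
    rintro i ⟨-, N, _, _, hN, hN'⟩
    exact hN' hN⟩
  have hwf : WellFounded lt := Finite.wellFounded_of_trans_of_irrefl lt
  let S : Set (Fin n) := {i | ∃ (T : ModPred R) (U : Type) (_ : AddCommGroup U) (_ : Module R U),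
    IsTorsionClass T ∧ IsExtGenerator T U ∧
    (∀ (N : Type) [AddCommGroup N] [Module R N], T' N → T N) ∧
    ∀ (N : Type) [AddCommGroup N] [Module R N], T N ↔ F i N}
  have hS : S.Nonempty := by
    have hT : IsTorsionClass (R := R) (Fac R) := isTorsionClass_fac K LiftsAlong.of_projective
    obtain ⟨U, _, _, hU⟩ := hT.exists_extGenerator K (Fac.self R) fun _ _ _ h => h
    obtain ⟨i, hi⟩ := hF _ U hT hU
    refine ⟨i, _, U, _, _, hT, hU, fun N _ _ hN => ?_, hi⟩
    have := hT'.finite N hN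
    exact fac_regular N
  obtain ⟨i, ⟨T, U, _, _, hT, hU, hle, hi⟩, hmin⟩ := hwf.has_min S hS
  refine ⟨i, fun N _ _ => ⟨fun h => (hi N).1 (hle N h), fun h => ?_⟩⟩
  by_contra hN
  obtain ⟨T₁, hT₁, hle₁, hlt, ⟨B, _, _, hB, hB₁⟩, V, _, _, hV⟩ :=
    hU.exists_between K hT hT' hle ((hi N).2 h) hN
  obtain ⟨j, hj⟩ := hF T₁ V hT₁ hV
  refine hmin j ⟨T₁, V, _, _, hT₁, hV, hle₁, hj⟩
    ⟨fun N _ _ h => (hi N).1 (hlt N ((hj N).2 h)), B, _, _, (hi B).1 hB, fun h => hB₁ ((hj B).2 h)⟩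

end

section

variable {R S : Type} [Ring R] [Ring S] (σ : R →+* S) [RingHomSurjective σ]

/-- The finitely generated `R`-modules all of whose quotients over `S` lie in `T`. -/
def torsionPullback (T : ModPred S) : ModPred R := fun N _ _ =>
  Module.Finite R N ∧ ∀ (Y : Type) [AddCommGroup Y] [Module S Y] (s : N →ₛₗ[σ] Y),
    Surjective s → T Y

theorem IsTorsionClass.torsionPullback {T : ModPred S} (hT : IsTorsionClass T) :
    IsTorsionClass (torsionPullback σ T) where
  finite _ _ _ h := h.1
  of_subsingleton N _ _ h :=
    ⟨inferInstance, fun Y _ _ _ hs => hT.of_subsingleton Y hs.subsingleton⟩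
  of_surjective f hf h :=
    ⟨have := h.1; Module.Finite.of_surjective f hf, fun Y _ _ s hs => h.2 Y (s.comp f) (hs.comp hf)⟩
  of_extension {E N} _ _ _ _ f hf hk hN := by
    refine ⟨?_, fun Y _ _ s hs => ?_⟩
    · have := hk.1
      have := hN.1
      have := Module.Finite.equiv (f.quotKerEquivOfSurjective hf).symm
      exact Module.Finite.of_submodule_quotient (LinearMap.ker f)
    let W : Submodule S Y := (LinearMap.ker f).map s
    have hle : LinearMap.ker f ≤ LinearMap.ker (W.mkQ.comp s) := fun x hx => by
      rw [LinearMap.mem_ker, LinearMap.comp_apply, Submodule.mkQ_apply,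
        Submodule.Quotient.mk_eq_zero]
      exact ⟨x, hx, rfl⟩
    have hQ : T (Y ⧸ W) := by
      refine hN.2 _ (((LinearMap.ker f).liftQ (W.mkQ.comp s) hle).comp
        (f.quotKerEquivOfSurjective hf).symm.toLinearMap) ?_
      intro y
      obtain ⟨x, rfl⟩ := (W.mkQ_surjective.comp hs) y
      refine ⟨f.quotKerEquivOfSurjective hf (Submodule.Quotient.mk x), ?_⟩
      simp only [LinearMap.comp_apply, LinearEquiv.coe_coe, LinearEquiv.symm_apply_apply]
      rfl
    have hW : T W := by
      refine hk.2 W ((s.comp (LinearMap.ker f).subtype).codRestrict W fun x => ⟨x, x.2, rfl⟩) ?_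
      rintro ⟨_, x, hx, rfl⟩
      exact ⟨⟨x, hx⟩, rfl⟩
    refine hT.of_extension W.mkQ W.mkQ_surjective ?_ hQ
    rw [Submodule.ker_mkQ]
    exact hW

theorem finite_of_smul_eq {Y : Type} [AddCommGroup Y] [Module S Y] [Module R Y]
    (h : ∀ (r : R) (y : Y), r • y = σ r • y) [Module.Finite S Y] : Module.Finite R Y := by
  obtain ⟨s, hs⟩ := Module.Finite.fg_top (R := S) (M := Y)
  refine ⟨s, eq_top_iff.2 fun y _ => ?_⟩
  have hy : y ∈ Submodule.span S (s : Set Y) := hs ▸ Submodule.mem_top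
  induction hy using Submodule.span_induction with
  | mem x hx => exact Submodule.subset_span hx
  | zero => exact zero_mem _
  | add x y _ _ hx hy => exact add_mem (hx trivial) (hy trivial)
  | smul a x _ hx =>
    obtain ⟨r, rfl⟩ := RingHomSurjective.is_surjective (σ := σ) a
    rw [← h]
    exact Submodule.smul_mem _ r (hx trivial)

theorem torsionPullback_iff {T : ModPred S} (hT : IsTorsionClass T) {Y : Type} [AddCommGroup Y]
    [Module S Y] [Module R Y] (h : ∀ (r : R) (y : Y), r • y = σ r • y) :
    torsionPullback σ T Y ↔ T Y := by
  refine ⟨fun hY => hY.2 Y { toFun := id, map_add' := fun _ _ => rfl, map_smul' := h }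
    surjective_id, fun hY => ?_⟩
  have := hT.finite Y hY
  refine ⟨finite_of_smul_eq σ h, fun Z _ _ s hs => ?_⟩
  let s' : Y →ₗ[S] Z :=
    { toFun := s
      map_add' := map_add s
      map_smul' := fun a y => by
        obtain ⟨r, rfl⟩ := RingHomSurjective.is_surjective (σ := σ) a
        rw [← h, map_smulₛₗ, RingHom.id_apply] }
  exact hT.of_surjective s' hs hY

include σ in
theorem HasFiniteTorsionClasses.of_surjective (h : HasFiniteTorsionClasses R) :
    HasFiniteTorsionClasses S := by
  obtain ⟨n, F, hF⟩ := h
  refine ⟨n, fun i Y _ _ => @F i Y _ (Module.compHom Y σ), fun T hT => ?_⟩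
  obtain ⟨i, hi⟩ := hF _ (hT.torsionPullback σ)
  refine ⟨i, fun Y _ _ => ?_⟩
  let _ : Module R Y := Module.compHom Y σ
  exact (torsionPullback_iff σ hT fun _ _ => rfl).symm.trans (hi Y)

end

section

variable {R : Type} [Ring R]

theorem IsTauRigidCat.liftsAlong {M : ModuleCat.{0} R} (h : IsTauRigidCat R M) :
    LiftsAlong (R := R) (Fac M) M := by
  obtain ⟨hM, P₁, P₀, f, g, h₁, hp₁, h₀, hp₀, hg, hfg, hext⟩ := h
  refine IsPresentation.liftsAlong (f := f) (g := g) ⟨h₁, hp₁, h₀, hp₀, hg, hfg, ?_⟩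
  rintro N _ _ ⟨k, u, hu⟩ t
  obtain ⟨t', rfl⟩ := Module.projective_lifting_property u t hu
  choose v hv using fun i => hext (LinearMap.proj i ∘ₗ t')
  refine ⟨u ∘ₗ LinearMap.pi v, ?_⟩
  ext x
  simp only [LinearMap.comp_apply]
  congr 1
  ext i
  exact (LinearMap.congr_fun (hv i) x).symm

theorem exists_fin_enumeration {ι α : Type*} [Finite ι] (G : ι → α) :
    ∃ (n : ℕ) (L : Fin n → α), ∀ i, ∃ a, L a = G i := by
  obtain ⟨n, ⟨φ⟩⟩ := Finite.exists_equiv_fin ι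
  exact ⟨n, G ∘ φ.symm, fun i => ⟨φ i, by simp⟩⟩

variable (K : Type) [Field K] [Algebra K R] [FiniteDimensional K R]

include K in
theorem IsExtGenerator.exists_fin_basic {T : ModPred R} (hT : IsTorsionClass T) {U : Type}
    [AddCommGroup U] [Module R U] (hU : IsExtGenerator T U) :
    ∃ (n : ℕ) (L : Fin n → ModuleCat.{0} R), ∀ M : ModuleCat.{0} R, IsBasicModuleCat R M →
      T M → LiftsAlong T M → ∃ i, Nonempty (M ≃ₗ[R] L i) := by
  classical
  obtain ⟨p, X, -, -, -, -, -, hXall⟩ := hU.exists_indec K hT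
  obtain ⟨n, L, hL⟩ := exists_fin_enumeration fun s : Set (Fin p) =>
    ModuleCat.of R (∀ i : s, X i)
  refine ⟨n, L, fun M ⟨k, N, hN, hNi, hNiso⟩ hM hl => ?_⟩
  obtain ⟨e⟩ := nonempty_equiv_pi_of_isInternal hN
  have hret : ∀ i, IsRetract R (N i) M := fun i =>
    (IsRetract.of_pi (Y := fun i => N i) i).trans (IsRetract.of_equiv e.symm)
  have hex : ∀ i, ∃ j, Nonempty (N i ≃ₗ[R] X j) := fun i => by
    obtain ⟨s, t, h⟩ := hret i
    exact hXall (N i) (hT.of_surjective t (fun x => ⟨s x, LinearMap.congr_fun h x⟩) hM)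
      (LiftsAlong.of_retract hl s t h) (hNi i)
  choose c hc using hex
  have hinj : Injective c := fun i j hij => by
    by_contra hne
    obtain ⟨f⟩ := hc i
    obtain ⟨g⟩ := hc j
    rw [← hij] at g
    exact (hNiso i j hne).false (f ≪≫ₗ g.symm)
  obtain ⟨a, ha⟩ := hL (Set.range c)
  refine ⟨a, ?_⟩
  rw [ha]
  exact ⟨e ≪≫ₗ (LinearEquiv.piCongrRight fun i => (hc i).some) ≪≫ₗ
    LinearEquiv.piCongrLeft R (fun i : Set.range c => X i) (Equiv.ofInjective c hinj)⟩

include K in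
theorem HasFiniteTorsionClasses.exists_fin_tauRigid (h : HasFiniteTorsionClasses R) :
    ∃ (n : ℕ) (L : Fin n → ModuleCat.{0} R), ∀ M : ModuleCat.{0} R, IsBasicModuleCat R M →
      IsTauRigidCat R M → ∃ i, Nonempty (M ≃ₗ[R] L i) := by
  have : IsArtinianRing R := IsArtinianRing.of_finite K R
  obtain ⟨n, F, hF⟩ := h
  have htors : ∀ M : ModuleCat.{0} R, IsTauRigidCat R M → IsTorsionClass (R := R) (Fac M) :=
    fun M hM => by
      have := hM.1
      exact isTorsionClass_fac K hM.liftsAlong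
  have key : ∀ i, ∃ (m : ℕ) (L : Fin m → ModuleCat.{0} R), ∀ M : ModuleCat.{0} R,
      IsBasicModuleCat R M → IsTauRigidCat R M →
      (∀ (N : Type) [AddCommGroup N] [Module R N], Fac (R := R) M N ↔ F i N) →
      ∃ j, Nonempty (M ≃ₗ[R] L j) := by
    intro i
    by_cases h : ∃ M : ModuleCat.{0} R, IsTauRigidCat R M ∧
      ∀ (N : Type) [AddCommGroup N] [Module R N], Fac (R := R) M N ↔ F i N
    · obtain ⟨M₀, h₀, hi₀⟩ := h
      obtain ⟨U, _, _, hU⟩ := (htors M₀ h₀).exists_extGenerator K (Fac.self M₀) fun _ _ _ h => h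
      obtain ⟨m, L, hL⟩ := hU.exists_fin_basic K (htors M₀ h₀)
      refine ⟨m, L, fun M hb hM hi => hL M hb ((hi₀ M).2 ((hi M).1 (Fac.self M))) ?_⟩
      intro E Y _ _ _ _ q hq hk
      exact hM.liftsAlong q hq ((hi _).2 ((hi₀ _).1 hk))
    · exact ⟨0, Fin.elim0, fun M _ hM hi => (h ⟨M, hM, hi⟩).elim⟩
  choose m L hL using key
  obtain ⟨k, L', hL'⟩ := exists_fin_enumeration fun x : (Σ i, Fin (m i)) => L x.1 x.2
  refine ⟨k, L', fun M hb hM => ?_⟩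
  obtain ⟨i, hi⟩ := hF _ (htors M hM)
  obtain ⟨j, hj⟩ := hL i M hb hM hi
  obtain ⟨a, ha⟩ := hL' ⟨i, j⟩
  exact ⟨a, by rwa [ha]⟩

end

end TwoPoint

namespace TwoPoint

/-- A τ-tilting finite basic algebra has only finitely many torsion classes. -/
theorem IsTauTiltingFinite.hasFiniteTorsionClasses (K : Type) [Field K] {Λ : Type} [Ring Λ]
    [Algebra K Λ] [FiniteDimensional K Λ] (hb : IsBasicAlgebra Λ) (h : IsTauTiltingFinite Λ) :
    HasFiniteTorsionClasses Λᵐᵒᵖ := by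
  obtain ⟨n, L, hL⟩ := h
  refine hasFiniteTorsionClasses_of_generators K (fun i => Fac (L i)) fun T U _ _ hT hU => ?_
  obtain ⟨M, hM, hMb, hMT⟩ := hU.exists_isSupportTauTiltingCat K hb hT
  obtain ⟨i, ⟨e⟩⟩ := hL M ⟨hM, hMb⟩
  refine ⟨i, fun N _ _ => (hMT N).trans ⟨?_, ?_⟩⟩
  · rintro ⟨k, f, hf⟩
    exact ⟨k, f ∘ₗ (LinearEquiv.piCongrRight fun _ => e.symm).toLinearMap,
      hf.comp (LinearEquiv.surjective _)⟩
  · rintro ⟨k, f, hf⟩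
    exact ⟨k, f ∘ₗ (LinearEquiv.piCongrRight fun _ => e).toLinearMap,
      hf.comp (LinearEquiv.surjective _)⟩

theorem isTauTiltingFinite_of_hasFiniteTorsionClasses (K : Type) [Field K] {Λ : Type} [Ring Λ]
    [Algebra K Λ] [FiniteDimensional K Λ] (h : HasFiniteTorsionClasses Λᵐᵒᵖ) :
    IsTauTiltingFinite Λ := by
  obtain ⟨n, L, hL⟩ := h.exists_fin_tauRigid K
  exact ⟨n, L, fun M hM => hL M hM.2 hM.1.1⟩

/-- Corollary 2.9.  Let `Λ₁, Λ₂` be finite dimensional basic algebras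
over an algebraically closed field `K` and assume `Λ₂` is a factor algebra of `Λ₁`.
If `Λ₂` is τ-tilting infinite then so is `Λ₁`. -/
theorem tau_tilting_infinite_of_factor_algebra (K : Type) [Field K] [IsAlgClosed K]
    (Λ₁ Λ₂ : Type) [Ring Λ₁] [Ring Λ₂] [Algebra K Λ₁] [Algebra K Λ₂]
    [FiniteDimensional K Λ₁] [FiniteDimensional K Λ₂]
    (hb₁ : IsBasicAlgebra Λ₁) (hb₂ : IsBasicAlgebra Λ₂)
    (h : IsFactorAlgebra K Λ₂ Λ₁) :
    ¬ IsTauTiltingFinite Λ₂ → ¬ IsTauTiltingFinite Λ₁ := by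
  intro h₂ h₁
  obtain ⟨φ, hφ⟩ := h
  let σ : Λ₁ᵐᵒᵖ →+* Λ₂ᵐᵒᵖ := RingHom.op φ.toRingHom
  have : RingHomSurjective σ := ⟨fun y => by
    obtain ⟨x, hx⟩ := hφ y.unop
    exact ⟨MulOpposite.op x, congrArg MulOpposite.op hx⟩⟩
  exact h₂ (isTauTiltingFinite_of_hasFiniteTorsionClasses K
    ((h₁.hasFiniteTorsionClasses K hb₁).of_surjective σ))

end TwoPoint
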